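/- Let Ω = 𝕋 × (0,∞), κ > 0. Suppose u, b : [0,T] × Ω → ℝ are smooth solutions of ∂_t u + U ∂_x u + v U' - ∂²_z u = κ ∂_x b with ∂_x u + ∂²_z b = 0, v = -∫₀^z ∂_x u, u = b = 0 at z = 0, with decay at z = ∞, where U : [0,∞) → ℝ satisfies z U' ∈ L^∞. Then for a.e. t: (1/2)(d/dt)‖u(t)‖²_{L²} + ‖∂_z u(t)‖²_{L²} + κ ‖∂_z b(t)‖²_{L²} ≤ ‖z U'‖_{L^∞} ( ‖∂_x u(t)‖²_{L²} + ‖u(t)‖²_{L²} ). -/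

import Mathlib

open Real Filter Topology MeasureTheory Set intervalIntegral

/-- The domain `Ω = 𝕋 × (0,∞)`, modeled as `(0,1] × (0,∞)` with period-1 functions. -/
noncomputable def μΩ : Measure (ℝ × ℝ) :=
  (volume.restrict (Ioc (0:ℝ) 1)).prod (volume.restrict (Ioi (0:ℝ)))

noncomputable def dX (f : ℝ → ℝ → ℝ) (x z : ℝ) : ℝ := deriv (fun x' => f x' z) x
noncomputable def dZ (f : ℝ → ℝ → ℝ) (x z : ℝ) : ℝ := deriv (fun z' => f x z') z

/-- squared L² norm on Ω -/
noncomputable def sqL2 (f : ℝ → ℝ → ℝ) : ℝ := ∫ p, (f p.1 p.2)^2 ∂μΩ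


theorem abs_step (α β : ℝ) (E : ℝ → ℝ) (hE : ∀ s ∈ Ioo α β, DifferentiableAt ℝ E s)
    (En G err H Dm : ℕ → ℝ → ℝ) (D : ℝ → ℝ) (A c : ℝ) (hc : 0 < c)
    (hEn : ∀ s ∈ Ioo α β, Tendsto (fun n => En n s) atTop (𝓝 (E s)))
    (hFTC : ∀ n, ∀ x y, α < x → x ≤ y → y < β → En n y - En n x = ∫ s in x..y, G n s)
    (hGH : ∀ m n, m ≤ n → ∀ s ∈ Ioo α β, G n s ≤ H m s + err n s)
    (hGc : ∀ n, Continuous (G n)) (herrc : ∀ n, Continuous (err n))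
    (hHc : ∀ n, Continuous (H n)) (hDc : ∀ n, Continuous (Dm n))
    (herr0 : ∀ s ∈ Ioo α β, Tendsto (fun n => err n s) atTop (𝓝 0))
    (herrb : ∀ n, ∀ s ∈ Ioo α β, |err n s| ≤ A * (1 + D s))
    (hD0 : ∀ n s, 0 ≤ Dm n s)
    (hDlim : ∀ s ∈ Ioo α β, Tendsto (fun n => Dm n s) atTop (𝓝 (D s)))
    (p q C' : ℝ) (hpq : Ioo p q ⊆ Ioo α β)
    (hb : ∀ s ∈ Ioo p q, ∀ m, deriv E s + c * Dm m s ≤ C') :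
    ∀ s ∈ Ioo p q, ∀ m, deriv E s ≤ H m s := by
  have key : ∀ m, ∀ x ∈ Ioo p q, ∀ y ∈ Ioo p q, x ≤ y → E y - E x ≤ ∫ s in x..y, H m s := by
    intro m x hx y hy hxy
    have hsub : Icc x y ⊆ Ioo p q := fun s hs => ⟨hx.1.trans_le hs.1, hs.2.trans_lt hy.2⟩
    have hsub' : Icc x y ⊆ Ioo α β := hsub.trans hpq
    have hbd : ∀ k, c * ∫ s in x..y, Dm k s ≤ C' * (y - x) - (E y - E x) := by
      intro k
      have := intervalIntegral.sub_le_integral_of_hasDeriv_right_of_le (g := E) (g' := deriv E)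
        (φ := fun s => C' - c * Dm k s) hxy
        (fun s hs => (hE s (hsub' hs)).continuousAt.continuousWithinAt)
        (fun s hs => (hE s (hsub' (Ioo_subset_Icc_self hs))).hasDerivAt.hasDerivWithinAt)
        (by
          have := hDc k
          exact (Continuous.continuousOn (by fun_prop)).integrableOn_Icc)
        (fun s hs => by have := hb s (hsub (Ioo_subset_Icc_self hs)) k; linarith)
      have hi : IntervalIntegrable (fun s => c * Dm k s) volume x y :=
        (Continuous.intervalIntegrable (by have := hDc k; fun_prop) _ _)
      rw [intervalIntegral.integral_sub (by simp) hi, intervalIntegral.integral_const,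
        intervalIntegral.integral_const_mul] at this
      simp only [smul_eq_mul] at this
      linarith
    have hDint : Integrable D (volume.restrict (Ioc x y)) := by
      refine integrable_of_tendsto (G := Dm) ?_ (fun n => (hDc n).aestronglyMeasurable) ?_
      · refine (ae_restrict_iff' measurableSet_Ioc).2 (ae_of_all _ fun s hs => ?_)
        exact hDlim s (hsub' (Ioc_subset_Icc_self hs))
      · have h1 : ∀ n, ∫⁻ s in Ioc x y, ‖Dm n s‖ₑ
            ≤ ENNReal.ofReal ((C' * (y - x) - (E y - E x)) / c) := by
          intro n
          have h2 : ∫⁻ s in Ioc x y, ‖Dm n s‖ₑ = ENNReal.ofReal (∫ s in Ioc x y, Dm n s) := by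
            rw [ofReal_integral_eq_lintegral_ofReal]
            · refine lintegral_congr fun s => ?_
              exact Real.enorm_of_nonneg (hD0 n s)
            · exact ((hDc n).integrableOn_Icc).mono_set Ioc_subset_Icc_self
            · exact ae_of_all _ (hD0 n)
          rw [h2]
          apply ENNReal.ofReal_le_ofReal
          rw [le_div_iff₀ hc, ← intervalIntegral.integral_of_le hxy]
          linarith [hbd n]
        refine ne_top_of_le_ne_top ENNReal.ofReal_ne_top
          (liminf_le_of_frequently_le' (Frequently.of_forall h1))
    have hlim : Tendsto (fun n => ∫ s in x..y, (H m s + err n s)) atTop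
        (𝓝 (∫ s in x..y, H m s)) := by
      apply intervalIntegral.tendsto_integral_filter_of_dominated_convergence
        (fun s => |H m s| + A * (1 + D s))
      · exact Eventually.of_forall fun n => by
          have := hHc m; have := herrc n
          exact Continuous.aestronglyMeasurable (by fun_prop)
      · refine Eventually.of_forall fun n => ae_of_all _ fun s hs => ?_
        rw [uIoc_of_le hxy] at hs
        have := herrb n s (hsub' (Ioc_subset_Icc_self hs))
        rw [Real.norm_eq_abs]
        exact (abs_add_le _ _).trans (by linarith)
      · rw [intervalIntegrable_iff_integrableOn_Ioc_of_le hxy]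
        refine Integrable.add ?_ ?_
        · have := hHc m
          exact ((Continuous.integrableOn_Icc (by fun_prop)).mono_set Ioc_subset_Icc_self)
        · exact ((integrable_const _).add hDint).const_mul A
      · refine ae_of_all _ fun s hs => ?_
        rw [uIoc_of_le hxy] at hs
        have := (herr0 s (hsub' (Ioc_subset_Icc_self hs))).const_add (H m s)
        simpa using this
    refine le_of_tendsto_of_tendsto ((hEn y (hpq hy)).sub (hEn x (hpq hx))) hlim ?_
    filter_upwards [eventually_ge_atTop m] with n hn
    rw [hFTC n x y (hpq hx).1 hxy (hpq hy).2]
    apply intervalIntegral.integral_mono_on hxy ((hGc n).intervalIntegrable _ _)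
    · have := hHc m; have := herrc n
      exact Continuous.intervalIntegrable (by fun_prop) _ _
    · intro s hs
      exact hGH m n hn s (hsub' hs)
  intro s hs m
  have hmono : MonotoneOn (fun t => (∫ r in s..t, H m r) - E t) (Ioo p q) := by
    intro x hx y hy hxy
    have := key m x hx y hy hxy
    have h2 := intervalIntegral.integral_add_adjacent_intervals
      ((hHc m).intervalIntegrable (μ := volume) s x) ((hHc m).intervalIntegrable x y)
    simp only
    linarith
  have hd : HasDerivAt (fun t => (∫ r in s..t, H m r) - E t) (H m s - deriv E s) s :=
    ((hHc m).integral_hasStrictDerivAt s s).hasDerivAt.sub (hE s (hpq hs)).hasDerivAt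
  have := hmono.derivWithin_nonneg (x := s)
  rw [hd.hasDerivWithinAt.derivWithin (isOpen_Ioo.uniqueDiffWithinAt hs)] at this
  linarith

theorem abs_main (α β : ℝ) (E : ℝ → ℝ) (hE : ∀ s ∈ Ioo α β, DifferentiableAt ℝ E s)
    (En G err H Dm : ℕ → ℝ → ℝ) (D : ℝ → ℝ) (A C c : ℝ) (hc : 0 < c)
    (hEn : ∀ s ∈ Ioo α β, Tendsto (fun n => En n s) atTop (𝓝 (E s)))
    (hFTC : ∀ n, ∀ x y, α < x → x ≤ y → y < β → En n y - En n x = ∫ s in x..y, G n s)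
    (hGH : ∀ m n, m ≤ n → ∀ s ∈ Ioo α β, G n s ≤ H m s + err n s)
    (hGc : ∀ n, Continuous (G n)) (herrc : ∀ n, Continuous (err n))
    (hHc : ∀ n, Continuous (H n)) (hDc : ∀ n, Continuous (Dm n))
    (herr0 : ∀ s ∈ Ioo α β, Tendsto (fun n => err n s) atTop (𝓝 0))
    (herrb : ∀ n, ∀ s ∈ Ioo α β, |err n s| ≤ A * (1 + D s))
    (hD0 : ∀ n s, 0 ≤ Dm n s)
    (hDle : ∀ n, ∀ s ∈ Ioo α β, Dm n s ≤ D s)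
    (hDlim : ∀ s ∈ Ioo α β, Tendsto (fun n => Dm n s) atTop (𝓝 (D s)))
    (hH : ∀ m, ∀ s ∈ Ioo α β, H m s ≤ C - c * Dm m s) :
    ∀ s ∈ Ioo α β, ∀ m, deriv E s ≤ H m s := by
  set O : Set ℝ := interior {s | ∀ m, deriv E s ≤ H m s} with hO
  by_contra hcon
  have hKne : (Ioo α β ∩ Oᶜ).Nonempty := by
    by_contra hne
    apply hcon
    intro s hs
    by_contra h
    apply hne
    refine ⟨s, hs, fun hsO => h (interior_subset hsO)⟩
  set K : Set ℝ := Ioo α β ∩ Oᶜ with hK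
  have hKlc : IsLocallyClosed K :=
    isOpen_Ioo.isLocallyClosed.inter (isOpen_interior.isClosed_compl).isLocallyClosed
  have : LocallyCompactSpace K := hKlc.locallyCompactSpace
  have : Nonempty K := hKne.to_subtype
  let Kn : ℕ → Set K := fun n => {s | (∀ m, Dm m s ≤ n) ∧
    ∀ t, |t - (s:ℝ)| < 1 / ((n:ℝ) + 1) → t ∈ Ioo α β → |E t - E s| ≤ n * |t - s|}
  have hEc : Continuous (fun s : K => E s) := by
    rw [continuous_iff_continuousAt]
    intro s
    exact ContinuousAt.comp (f := fun s : K => (s:ℝ)) (g := E) (hE s s.2.1).continuousAt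
      continuous_subtype_val.continuousAt
  have hclosed : ∀ n, IsClosed (Kn n) := by
    intro n
    have : Kn n = (⋂ m, {s : K | Dm m s ≤ n}) ∩ ⋂ t, ({s : K | 1 / ((n:ℝ) + 1) ≤ |t - (s:ℝ)|} ∪
        {s : K | t ∈ Ioo α β → |E t - E s| ≤ n * |t - s|}) := by
      ext s
      simp only [Kn, mem_ofPred_eq, mem_inter_iff, mem_iInter, mem_union]
      refine and_congr Iff.rfl (forall_congr' fun t => ?_)
      by_cases h : |t - (s:ℝ)| < 1 / ((n:ℝ) + 1)
      · simp only [h, forall_true_left, not_le.2 h, false_or]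
      · simp only [h, false_imp_iff, not_lt.1 h, true_or]
    rw [this]
    refine IsClosed.inter (isClosed_iInter fun m => ?_) (isClosed_iInter fun t => ?_)
    · exact isClosed_le ((hDc m).comp continuous_subtype_val) continuous_const
    · refine IsClosed.union (isClosed_le continuous_const (by fun_prop)) ?_
      by_cases ht : t ∈ Ioo α β
      · simp only [ht, forall_true_left]
        exact isClosed_le (continuous_const.sub hEc).abs (by fun_prop)
      · simp [ht]
  have hcover : ⋃ n, Kn n = univ := by
    refine eq_univ_of_forall fun s => ?_
    have hd := (hE s s.2.1).hasDerivAt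
    have hO1 := hd.isLittleO
    have hO2 := hO1.def (c := 1) one_pos
    obtain ⟨δ, hδ, hball⟩ := Metric.eventually_nhds_iff.1 hO2
    obtain ⟨n1, hn1⟩ := exists_nat_ge (D s)
    obtain ⟨n2, hn2⟩ := exists_nat_ge (|deriv E s| + 1)
    obtain ⟨n3, hn3⟩ := exists_nat_one_div_lt hδ
    refine mem_iUnion.2 ⟨n1 + n2 + n3, ?_, ?_⟩
    · intro m
      refine (hDle m s s.2.1).trans (hn1.trans ?_)
      push_cast
      have : (0:ℝ) ≤ n2 := Nat.cast_nonneg _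
      have : (0:ℝ) ≤ n3 := Nat.cast_nonneg _
      linarith
    · intro t ht _
      have h0 : (0:ℝ) ≤ n1 := Nat.cast_nonneg _
      have h1 : (0:ℝ) ≤ n2 := Nat.cast_nonneg _
      have h2 : (0:ℝ) ≤ n3 := Nat.cast_nonneg _
      have h3 : 1 / (((n1 + n2 + n3 : ℕ):ℝ) + 1) ≤ 1 / ((n3:ℝ) + 1) := by
        apply one_div_le_one_div_of_le (by positivity)
        push_cast; linarith
      have h4 := hball (y := t) (by rw [Real.dist_eq]; linarith)
      simp only [smul_eq_mul, Real.norm_eq_abs, one_mul] at h4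
      have h5 : |E t - E s| ≤ |E t - E s - (t - s) * deriv E s| + |(t - s) * deriv E s| := by
        have := abs_add_le (E t - E s - (t - s) * deriv E s) ((t - s) * deriv E s)
        simpa using this
      rw [abs_mul] at h5
      have h6 : |t - (s:ℝ)| * (|deriv E s| + 1) ≤ |t - (s:ℝ)| * ((n1 + n2 + n3 : ℕ):ℝ) := by
        apply mul_le_mul_of_nonneg_left _ (abs_nonneg _)
        push_cast; linarith
      linarith
  obtain ⟨n, s0, hs0⟩ := nonempty_interior_of_iUnion_of_closed hclosed hcover
  have hnb := mem_interior_iff_mem_nhds.1 hs0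
  obtain ⟨ε1, hε1, hb1⟩ := Metric.mem_nhds_iff.1 hnb
  obtain ⟨ε2, hε2, hb2⟩ := Metric.mem_nhds_iff.1 (isOpen_Ioo.mem_nhds s0.2.1)
  set ε := min ε1 ε2 with hε
  have hεpos : 0 < ε := lt_min hε1 hε2
  have hsub : Ioo ((s0:ℝ) - ε) (s0 + ε) ⊆ Ioo α β := by
    rw [← Real.ball_eq_Ioo]
    exact (Metric.ball_subset_ball (min_le_right _ _)).trans hb2
  have hfin := abs_step α β E hE En G err H Dm D A c hc hEn hFTC hGH hGc herrc hHc hDc herr0 herrb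
    hD0 hDlim (s0 - ε) (s0 + ε) (max C (n + c * n)) hsub (by
      intro s hs m
      by_cases hsO : s ∈ O
      · have h1 := interior_subset hsO m
        have h2 := hH m s (hsub hs)
        refine le_trans ?_ (le_max_left _ _)
        linarith
      · have hsK : s ∈ K := ⟨hsub hs, hsO⟩
        have hmem : (⟨s, hsK⟩ : K) ∈ Kn n := by
          apply hb1
          rw [Metric.mem_ball, Subtype.dist_eq]
          rw [← Real.ball_eq_Ioo] at hs
          exact lt_of_lt_of_le hs (min_le_left _ _)
        have h1 := hmem.1 m
        have h2 : ‖deriv E s‖ ≤ n := by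
          refine (hE s (hsub hs)).hasDerivAt.le_of_lip' (Nat.cast_nonneg _) ?_
          filter_upwards [isOpen_Ioo.mem_nhds (hsub hs),
            Metric.ball_mem_nhds s (show (0:ℝ) < 1 / ((n:ℝ)+1) by positivity)] with t ht1 ht2
          exact hmem.2 t ht2 ht1
        rw [Real.norm_eq_abs] at h2
        refine le_trans ?_ (le_max_right _ _)
        have := le_abs_self (deriv E s)
        have := mul_le_mul_of_nonneg_left h1 hc.le
        linarith)
  apply s0.2.2
  rw [hO, mem_interior]
  exact ⟨_, hfin, isOpen_Ioo, by constructor <;> linarith⟩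

theorem pd_hasDerivX {f : ℝ → ℝ → ℝ → ℝ}
    (hf : ContDiff ℝ (⊤ : ℕ∞) (fun p : ℝ × ℝ × ℝ => f p.1 p.2.1 p.2.2)) (t x z : ℝ) :
    HasDerivAt (fun x' => f t x' z)
      (fderiv ℝ (fun p : ℝ × ℝ × ℝ => f p.1 p.2.1 p.2.2) (t, x, z) (0, 1, 0)) x := by
  have h1 := (hf.differentiable (by simp) (t, x, z)).hasFDerivAt
  have h2 : HasDerivAt (fun x' : ℝ => ((t, x', z) : ℝ × ℝ × ℝ)) (0, 1, 0) x :=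
    (hasDerivAt_const x t).prodMk ((hasDerivAt_id x).prodMk (hasDerivAt_const x z))
  exact h1.comp_hasDerivAt x h2

theorem pd_hasDerivZ {f : ℝ → ℝ → ℝ → ℝ}
    (hf : ContDiff ℝ (⊤ : ℕ∞) (fun p : ℝ × ℝ × ℝ => f p.1 p.2.1 p.2.2)) (t x z : ℝ) :
    HasDerivAt (fun z' => f t x z')
      (fderiv ℝ (fun p : ℝ × ℝ × ℝ => f p.1 p.2.1 p.2.2) (t, x, z) (0, 0, 1)) z := by
  have h1 := (hf.differentiable (by simp) (t, x, z)).hasFDerivAt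
  have h2 : HasDerivAt (fun z' : ℝ => ((t, x, z') : ℝ × ℝ × ℝ)) (0, 0, 1) z :=
    (hasDerivAt_const z t).prodMk ((hasDerivAt_const z x).prodMk (hasDerivAt_id z))
  exact h1.comp_hasDerivAt z h2

theorem pd_hasDerivT {f : ℝ → ℝ → ℝ → ℝ}
    (hf : ContDiff ℝ (⊤ : ℕ∞) (fun p : ℝ × ℝ × ℝ => f p.1 p.2.1 p.2.2)) (t x z : ℝ) :
    HasDerivAt (fun t' => f t' x z)
      (fderiv ℝ (fun p : ℝ × ℝ × ℝ => f p.1 p.2.1 p.2.2) (t, x, z) (1, 0, 0)) t := by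
  have h1 := (hf.differentiable (by simp) (t, x, z)).hasFDerivAt
  have h2 : HasDerivAt (fun t' : ℝ => ((t', x, z) : ℝ × ℝ × ℝ)) (1, 0, 0) t :=
    (hasDerivAt_id t).prodMk ((hasDerivAt_const t x).prodMk (hasDerivAt_const t z))
  exact h1.comp_hasDerivAt t h2

theorem pd_smooth {F : ℝ × ℝ × ℝ → ℝ} (hF : ContDiff ℝ (⊤ : ℕ∞) F) (e : ℝ × ℝ × ℝ) :
    ContDiff ℝ (⊤ : ℕ∞) (fun p => fderiv ℝ F p e) :=
  (hF.fderiv_right (m := (⊤ : ℕ∞)) (by simp)).clm_apply contDiff_const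

theorem sm_X {f : ℝ → ℝ → ℝ → ℝ}
    (hf : ContDiff ℝ (⊤ : ℕ∞) (fun p : ℝ × ℝ × ℝ => f p.1 p.2.1 p.2.2)) :
    ContDiff ℝ (⊤ : ℕ∞) (fun p : ℝ × ℝ × ℝ => dX (f p.1) p.2.1 p.2.2) := by
  have : (fun p : ℝ × ℝ × ℝ => dX (f p.1) p.2.1 p.2.2) = fun p =>
      fderiv ℝ (fun p : ℝ × ℝ × ℝ => f p.1 p.2.1 p.2.2) p (0, 1, 0) := by
    funext p; exact (pd_hasDerivX hf p.1 p.2.1 p.2.2).deriv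
  rw [this]; exact pd_smooth hf _

theorem sm_Z {f : ℝ → ℝ → ℝ → ℝ}
    (hf : ContDiff ℝ (⊤ : ℕ∞) (fun p : ℝ × ℝ × ℝ => f p.1 p.2.1 p.2.2)) :
    ContDiff ℝ (⊤ : ℕ∞) (fun p : ℝ × ℝ × ℝ => dZ (f p.1) p.2.1 p.2.2) := by
  have : (fun p : ℝ × ℝ × ℝ => dZ (f p.1) p.2.1 p.2.2) = fun p =>
      fderiv ℝ (fun p : ℝ × ℝ × ℝ => f p.1 p.2.1 p.2.2) p (0, 0, 1) := by
    funext p; exact (pd_hasDerivZ hf p.1 p.2.1 p.2.2).deriv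
  rw [this]; exact pd_smooth hf _

theorem sm_T {f : ℝ → ℝ → ℝ → ℝ}
    (hf : ContDiff ℝ (⊤ : ℕ∞) (fun p : ℝ × ℝ × ℝ => f p.1 p.2.1 p.2.2)) :
    ContDiff ℝ (⊤ : ℕ∞) (fun p : ℝ × ℝ × ℝ => deriv (fun s => f s p.2.1 p.2.2) p.1) := by
  have : (fun p : ℝ × ℝ × ℝ => deriv (fun s => f s p.2.1 p.2.2) p.1) = fun p =>
      fderiv ℝ (fun p : ℝ × ℝ × ℝ => f p.1 p.2.1 p.2.2) p (1, 0, 0) := by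
    funext p; exact (pd_hasDerivT hf p.1 p.2.1 p.2.2).deriv
  rw [this]; exact pd_smooth hf _

theorem hd_X {f : ℝ → ℝ → ℝ → ℝ}
    (hf : ContDiff ℝ (⊤ : ℕ∞) (fun p : ℝ × ℝ × ℝ => f p.1 p.2.1 p.2.2)) (t x z : ℝ) :
    HasDerivAt (fun x' => f t x' z) (dX (f t) x z) x :=
  (pd_hasDerivX hf t x z).differentiableAt.hasDerivAt

theorem hd_Z {f : ℝ → ℝ → ℝ → ℝ}
    (hf : ContDiff ℝ (⊤ : ℕ∞) (fun p : ℝ × ℝ × ℝ => f p.1 p.2.1 p.2.2)) (t x z : ℝ) :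
    HasDerivAt (fun z' => f t x z') (dZ (f t) x z) z :=
  (pd_hasDerivZ hf t x z).differentiableAt.hasDerivAt

theorem hd_T {f : ℝ → ℝ → ℝ → ℝ}
    (hf : ContDiff ℝ (⊤ : ℕ∞) (fun p : ℝ × ℝ × ℝ => f p.1 p.2.1 p.2.2)) (t x z : ℝ) :
    HasDerivAt (fun t' => f t' x z) (deriv (fun s => f s x z) t) t :=
  (pd_hasDerivT hf t x z).differentiableAt.hasDerivAt

/-- Hardy's inequality on a bounded interval, in integrated comparison form. -/
theorem hardy_cmp {f f' a g : ℝ → ℝ} {L : ℝ} (hL : 0 ≤ L)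
    (hf : ∀ z, HasDerivAt f (f' z) z) (hf' : Continuous f') (ha : Continuous a)
    (hg : Continuous g) (h0 : f 0 = 0)
    (hle : ∀ z, 0 < z → z < L → g z ≤ a z + (f z) ^ 2 / (4 * z ^ 2)) :
    ∫ z in (0:ℝ)..L, g z ≤ ∫ z in (0:ℝ)..L, (a z + (f' z) ^ 2) := by
  have hfc : Continuous f := continuous_iff_continuousAt.2 fun z => (hf z).continuousAt
  have hΦc : Continuous (fun z => f z * dslope f 0 z / 2) := by
    have : Continuous (dslope f 0) := by
      rw [continuous_iff_continuousAt]
      intro z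
      by_cases hz : z = 0
      · subst hz
        exact continuousAt_dslope_same.2 (hf 0).differentiableAt
      · exact (continuousAt_dslope_of_ne hz).2 (hf z).continuousAt
    fun_prop
  have key := intervalIntegral.sub_le_integral_of_hasDeriv_right_of_le
    (g := fun z => f z * dslope f 0 z / 2)
    (g' := fun z => f z * f' z / z - (f z) ^ 2 / (2 * z ^ 2))
    (φ := fun z => a z + (f' z) ^ 2 - g z) hL hΦc.continuousOn
    (by
      intro z hz
      have hz0 : z ≠ 0 := hz.1.ne'
      have h1 : HasDerivAt (fun z => (f z) ^ 2 / (2 * z))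
          (f z * f' z / z - (f z) ^ 2 / (2 * z ^ 2)) z := by
        have := ((hf z).pow 2).div ((hasDerivAt_id z).const_mul 2)
          (by simpa using hz0)
        refine HasDerivAt.congr_deriv this ?_
        simp only [Pi.pow_apply, id, Nat.cast_ofNat]
        field_simp
        try ring
      refine (h1.congr_of_eventuallyEq ?_).hasDerivWithinAt
      filter_upwards [isOpen_ne.mem_nhds hz0] with y hy
      have hy' : y ≠ 0 := hy
      rw [dslope_of_ne _ hy, slope_def_field, h0]
      field_simp
      ring)
    (by exact (Continuous.continuousOn (by fun_prop)).integrableOn_Icc)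
    (by
      intro z hz
      have h1 := hle z hz.1 hz.2
      have hz0 : z ≠ 0 := hz.1.ne'
      have h2 : 0 ≤ (f' z - f z / (2 * z)) ^ 2 := sq_nonneg _
      have h3 : (f' z - f z / (2 * z)) ^ 2 = (f' z) ^ 2 - f z * f' z / z
        + (f z) ^ 2 / (4 * z ^ 2) := by field_simp; ring
      have h4 : (f z) ^ 2 / (2 * z ^ 2) = 2 * ((f z) ^ 2 / (4 * z ^ 2)) := by field_simp; ring
      rw [h4]
      linarith)
  rw [intervalIntegral.integral_sub (Continuous.intervalIntegrable (by fun_prop) _ _)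
    (hg.intervalIntegrable _ _)] at key
  have hpos : 0 ≤ f L * dslope f 0 L / 2 := by
    rcases hL.eq_or_lt with h | h
    · rw [← h, h0]; simp
    · rw [dslope_of_ne _ h.ne', slope_def_field, h0]
      have : f L * ((f L - 0) / (L - 0)) / 2 = (f L) ^ 2 / (2 * L) := by
        simp only [sub_zero]; field_simp
      rw [this]; positivity
  simp only [h0, zero_mul, zero_div, sub_zero] at key
  linarith

/-- Integration by parts against a cutoff. -/
theorem cut_ibp {f f' f'' c c' c'' : ℝ → ℝ} {L : ℝ}
    (hf : ∀ z, HasDerivAt f (f' z) z) (hf' : ∀ z, HasDerivAt f' (f'' z) z)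
    (hc : ∀ z, HasDerivAt c (c' z) z) (hc' : ∀ z, HasDerivAt c' (c'' z) z)
    (hfc : Continuous f'') (hcc : Continuous c'')
    (h0 : f 0 = 0) (hcL : c L = 0) (hcL' : c' L = 0) :
    ∫ z in (0:ℝ)..L, c z * (f z * f'' z + (f' z) ^ 2) = ∫ z in (0:ℝ)..L, c'' z * (f z) ^ 2 / 2 := by
  have c1 : Continuous f := continuous_iff_continuousAt.2 fun z => (hf z).continuousAt
  have c2 : Continuous f' := continuous_iff_continuousAt.2 fun z => (hf' z).continuousAt
  have c3 : Continuous c := continuous_iff_continuousAt.2 fun z => (hc z).continuousAt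
  have c4 : Continuous c' := continuous_iff_continuousAt.2 fun z => (hc' z).continuousAt
  have hd : ∀ z ∈ uIcc 0 L, HasDerivAt (fun z => c z * (f z * f' z) - c' z * (f z) ^ 2 / 2)
      (c z * (f z * f'' z + (f' z) ^ 2) - c'' z * (f z) ^ 2 / 2) z := by
    intro z _
    have := ((hc z).mul ((hf z).mul (hf' z))).sub (((hc' z).mul ((hf z).pow 2)).div_const 2)
    refine HasDerivAt.congr_deriv this ?_
    simp only [Pi.mul_apply, Pi.pow_apply, Nat.cast_ofNat]
    ring
  have := intervalIntegral.integral_eq_sub_of_hasDerivAt hd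
    (Continuous.intervalIntegrable (by fun_prop) _ _)
  rw [intervalIntegral.integral_sub (Continuous.intervalIntegrable (by fun_prop) _ _)
    (Continuous.intervalIntegrable (by fun_prop) _ _)] at this
  simp only [h0, hcL, hcL'] at this
  linarith

theorem muOmega_eq : μΩ = volume.restrict (Ioc (0:ℝ) 1 ×ˢ Ioi (0:ℝ)) := by
  rw [μΩ, Measure.prod_restrict]; rfl

instance sfinite_muOmega : SFinite μΩ := by
  rw [muOmega_eq]; infer_instance

theorem ae_Omega {P : ℝ × ℝ → Prop} (h : ∀ x z, 0 < x → x ≤ 1 → 0 < z → P (x, z)) :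
    ∀ᵐ p ∂μΩ, P p := by
  rw [muOmega_eq]
  refine (ae_restrict_iff' (measurableSet_Ioc.prod measurableSet_Ioi)).2 (ae_of_all _ ?_)
  rintro ⟨x, z⟩ hp
  exact h x z hp.1.1 hp.1.2 hp.2

theorem int_supp {f : ℝ × ℝ → ℝ} {L : ℝ} (hf : Continuous f)
    (hs : ∀ x z, L < z → f (x, z) = 0) : Integrable f μΩ := by
  rw [muOmega_eq]
  have h1 : IntegrableOn f (Icc (0:ℝ) 1 ×ˢ Icc (0:ℝ) L) :=
    hf.continuousOn.integrableOn_compact (isCompact_Icc.prod isCompact_Icc)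
  refine h1.of_forall_sdiff_eq_zero (measurableSet_Ioc.prod measurableSet_Ioi) ?_
  rintro ⟨x, z⟩ ⟨h2, h3⟩
  apply hs
  by_contra h
  exact h3 ⟨Ioc_subset_Icc_self h2.1, le_of_lt h2.2, not_lt.1 h⟩

theorem inner_supp {g : ℝ → ℝ} {L : ℝ} (hL : 0 ≤ L) (hs : ∀ z, L < z → g z = 0) :
    ∫ z in Ioi (0:ℝ), g z = ∫ z in (0:ℝ)..L, g z := by
  rw [intervalIntegral.integral_of_le hL]
  refine setIntegral_eq_of_subset_of_forall_sdiff_eq_zero measurableSet_Ioi Ioc_subset_Ioi_self ?_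
  rintro z ⟨h1, h2⟩
  apply hs
  by_contra h
  exact h2 ⟨h1, not_lt.1 h⟩

theorem iter_supp {f : ℝ × ℝ → ℝ} {L : ℝ} (hL : 0 ≤ L) (hf : Continuous f)
    (hs : ∀ x z, L < z → f (x, z) = 0) :
    ∫ p, f p ∂μΩ = ∫ x in (0:ℝ)..1, ∫ z in (0:ℝ)..L, f (x, z) := by
  have hi := int_supp hf hs
  rw [μΩ] at hi ⊢
  rw [integral_prod _ hi, intervalIntegral.integral_of_le zero_le_one]
  exact integral_congr_ae (ae_of_all _ fun x => inner_supp hL (hs x))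

theorem iter_supp' {f : ℝ × ℝ → ℝ} {L : ℝ} (hf : Continuous f)
    (hs : ∀ x z, L < z → f (x, z) = 0) :
    ∫ p, f p ∂μΩ = ∫ z in Ioi (0:ℝ), ∫ x in (0:ℝ)..1, f (x, z) := by
  have hi := int_supp hf hs
  rw [μΩ] at hi ⊢
  rw [integral_prod_symm _ hi]
  exact integral_congr_ae (ae_of_all _ fun x =>
    (intervalIntegral.integral_of_le zero_le_one).symm)

theorem cont_param {F : ℝ × ℝ × ℝ → ℝ} {L : ℝ} (hL : 0 ≤ L) (hF : Continuous F)
    (hs : ∀ s x z, L < z → F (s, x, z) = 0) : Continuous (fun s => ∫ p, F (s, p) ∂μΩ) := by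
  have : (fun s => ∫ p, F (s, p) ∂μΩ) =
      fun s => ∫ x in (0:ℝ)..1, ∫ z in (0:ℝ)..L, F (s, x, z) := by
    funext s
    exact iter_supp hL (by fun_prop) (hs s)
  rw [this]
  apply intervalIntegral.continuous_parametric_intervalIntegral_of_continuous'
  apply intervalIntegral.continuous_parametric_intervalIntegral_of_continuous'
    (f := fun (q : ℝ × ℝ) z => F (q.1, q.2, z))
  simp only [Function.uncurry_def]
  fun_prop

theorem ftc_param {F F' : ℝ × ℝ × ℝ → ℝ} {L : ℝ} (hF : Continuous F) (hF' : Continuous F')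
    (hd : ∀ s x z, HasDerivAt (fun s => F (s, x, z)) (F' (s, x, z)) s)
    (hs : ∀ s x z, L < z → F (s, x, z) = 0) (hs' : ∀ s x z, L < z → F' (s, x, z) = 0)
    (a b : ℝ) : (∫ p, F (b, p) ∂μΩ) - ∫ p, F (a, p) ∂μΩ = ∫ s in a..b, ∫ p, F' (s, p) ∂μΩ := by
  rw [intervalIntegral_integral_swap (f := fun s p => F' (s, p))]
  · rw [← integral_sub (int_supp (by fun_prop) (hs b)) (int_supp (by fun_prop) (hs a))]
    refine integral_congr_ae (ae_of_all _ ?_)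
    rintro ⟨x, z⟩
    exact (intervalIntegral.integral_eq_sub_of_hasDerivAt (fun s _ => hd s x z)
      (Continuous.intervalIntegrable (by fun_prop) _ _)).symm
  · rw [muOmega_eq, Measure.prod_restrict]
    have h1 : IntegrableOn (fun q : ℝ × ℝ × ℝ => F' q)
        (uIcc a b ×ˢ (Icc (0:ℝ) 1 ×ˢ Icc (0:ℝ) L)) (volume.prod volume) :=
      hF'.continuousOn.integrableOn_compact
        (isCompact_uIcc.prod (isCompact_Icc.prod isCompact_Icc))
    refine h1.of_forall_sdiff_eq_zero
      (measurableSet_uIoc.prod (measurableSet_Ioc.prod measurableSet_Ioi)) ?_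
    rintro ⟨s, x, z⟩ ⟨h2, h3⟩
    apply hs'
    by_contra h
    exact h3 ⟨uIoc_subset_uIcc h2.1, Ioc_subset_Icc_self h2.2.1, le_of_lt h2.2.2, not_lt.1 h⟩

theorem exists_cutoff : ∃ (c c1 c2 : ℕ → ℝ → ℝ) (C2 : ℝ), 0 ≤ C2 ∧
    (∀ n z, HasDerivAt (c n) (c1 n z) z) ∧ (∀ n z, HasDerivAt (c1 n) (c2 n z) z) ∧
    (∀ n, Continuous (c2 n)) ∧ (∀ n z, 0 ≤ c n z) ∧ (∀ n z, c n z ≤ 1) ∧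
    (∀ (n : ℕ) z, z ≤ (n:ℝ) + 1 → c n z = 1) ∧
    (∀ (n : ℕ) z, 3 * ((n:ℝ) + 1) ≤ z → c n z = 0 ∧ c1 n z = 0 ∧ c2 n z = 0) ∧
    (∀ m n, m ≤ n → ∀ z, 0 ≤ z → c m z ≤ c n z) ∧
    (∀ (n : ℕ) z, 0 ≤ z → |c2 n z| * ((n:ℝ) + 1) ^ 2 ≤ C2) := by
  set χ : ℝ → ℝ := fun z => Real.smoothTransition (2 - z) with hχ
  have hχs : ContDiff ℝ (⊤ : ℕ∞) χ := Real.smoothTransition.contDiff.comp (contDiff_const.sub contDiff_id)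
  have hχ1 : ContDiff ℝ (⊤ : ℕ∞) (deriv χ) :=
    (contDiff_infty_iff_deriv.1 hχs).2
  have hχ2 : ContDiff ℝ (⊤ : ℕ∞) (deriv (deriv χ)) :=
    (contDiff_infty_iff_deriv.1 hχ1).2
  have z0 : ∀ z, 2 < z → χ z = 0 := fun z hz => Real.smoothTransition.zero_of_nonpos (by linarith)
  have z1 : ∀ z, 2 < z → deriv χ z = 0 := by
    intro z hz
    have : χ =ᶠ[𝓝 z] fun _ => 0 := by
      filter_upwards [isOpen_Ioi.mem_nhds hz] with y hy using z0 y hy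
    rw [this.deriv_eq]; simp
  have z2 : ∀ z, 2 < z → deriv (deriv χ) z = 0 := by
    intro z hz
    have : deriv χ =ᶠ[𝓝 z] fun _ => 0 := by
      filter_upwards [isOpen_Ioi.mem_nhds hz] with y hy using z1 y hy
    rw [this.deriv_eq]; simp
  obtain ⟨C2, hC2⟩ := (isCompact_Icc (a := (0:ℝ)) (b := 2)).exists_bound_of_continuousOn
    hχ2.continuous.continuousOn
  have hC20 : 0 ≤ C2 := (norm_nonneg _).trans (hC2 0 (by simp))
  have hNpos : ∀ n : ℕ, (0:ℝ) < (n:ℝ) + 1 := fun n => by positivity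
  refine ⟨fun n z => χ (z / ((n:ℝ) + 1)), fun n z => deriv χ (z / ((n:ℝ) + 1)) / ((n:ℝ) + 1),
    fun n z => deriv (deriv χ) (z / ((n:ℝ) + 1)) / ((n:ℝ) + 1) ^ 2, C2, hC20, ?_, ?_, ?_, ?_, ?_,
    ?_, ?_, ?_, ?_⟩
  · intro n z
    have h1 := (hχs.differentiable (by simp) (z / ((n:ℝ) + 1))).hasDerivAt
    have h2 := h1.comp z ((hasDerivAt_id z).div_const ((n:ℝ) + 1))
    refine HasDerivAt.congr_deriv h2 ?_
    ring
  · intro n z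
    have h1 := (hχ1.differentiable (by simp) (z / ((n:ℝ) + 1))).hasDerivAt
    have h2 := (h1.comp z ((hasDerivAt_id z).div_const ((n:ℝ) + 1))).div_const ((n:ℝ) + 1)
    refine HasDerivAt.congr_deriv h2 ?_
    field_simp
  · intro n
    have := hχ2.continuous
    fun_prop
  · intro n z; exact Real.smoothTransition.nonneg _
  · intro n z; exact Real.smoothTransition.le_one _
  · intro n z hz
    apply Real.smoothTransition.one_of_one_le
    have : z / ((n:ℝ) + 1) ≤ 1 := (div_le_one (hNpos n)).2 hz
    linarith
  · intro n z hz
    have : 2 < z / ((n:ℝ) + 1) := by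
      rw [lt_div_iff₀ (hNpos n)]
      have := hNpos n
      linarith
    simp only [z0 _ this, z1 _ this, z2 _ this]
    simp
  · intro m n hmn z hz
    apply Real.smoothTransition.monotone
    have : z / ((n:ℝ) + 1) ≤ z / ((m:ℝ) + 1) := by
      apply div_le_div_of_nonneg_left hz (hNpos m)
      have : (m:ℝ) ≤ n := by exact_mod_cast hmn
      linarith
    linarith
  · intro n z hz
    have h1 : |deriv (deriv χ) (z / ((n:ℝ) + 1))| ≤ C2 := by
      by_cases h : z / ((n:ℝ) + 1) ≤ 2
      · exact hC2 _ ⟨div_nonneg hz (hNpos n).le, h⟩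
      · rw [z2 _ (not_le.1 h)]; simpa using hC20
    have hp : (0:ℝ) < ((n:ℝ) + 1) ^ 2 := pow_pos (hNpos n) 2
    rw [abs_div, abs_of_pos hp, div_mul_cancel₀ _ hp.ne']
    exact h1

theorem ibp2 {f f1 f2 : ℝ × ℝ → ℝ} {c c1 c2 : ℝ → ℝ} {L : ℝ} (hL : 0 ≤ L)
    (hf : Continuous f) (hf1 : Continuous f1) (hf2 : Continuous f2)
    (hd : ∀ x z, HasDerivAt (fun z => f (x, z)) (f1 (x, z)) z)
    (hd1 : ∀ x z, HasDerivAt (fun z => f1 (x, z)) (f2 (x, z)) z)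
    (h0 : ∀ x, f (x, 0) = 0)
    (hc : ∀ z, HasDerivAt c (c1 z) z) (hc' : ∀ z, HasDerivAt c1 (c2 z) z) (hcc : Continuous c2)
    (hs : ∀ z, L ≤ z → c z = 0 ∧ c1 z = 0 ∧ c2 z = 0) :
    ∫ p, c p.2 * (f p * f2 p + f1 p ^ 2) ∂μΩ = ∫ p, c2 p.2 * f p ^ 2 / 2 ∂μΩ := by
  have c3 : Continuous c := continuous_iff_continuousAt.2 fun z => (hc z).continuousAt
  rw [iter_supp hL (by fun_prop) (fun x z hz => by simp [(hs z hz.le).1]),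
    iter_supp hL (by fun_prop) (fun x z hz => by simp [(hs z hz.le).2.2])]
  refine intervalIntegral.integral_congr fun x _ => ?_
  exact cut_ibp (fun z => hd x z) (fun z => hd1 x z) hc hc' (by fun_prop) hcc (h0 x)
    (hs L le_rfl).1 (hs L le_rfl).2.1

theorem per0 {g g' : ℝ × ℝ → ℝ} {c : ℝ → ℝ} {L : ℝ} (hc : Continuous c) (hg' : Continuous g')
    (hd : ∀ x z, HasDerivAt (fun x => g (x, z)) (g' (x, z)) x)
    (hp : ∀ z, g (1, z) = g (0, z)) (hs : ∀ z, L < z → c z = 0) :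
    ∫ p, c p.2 * g' p ∂μΩ = 0 := by
  rw [iter_supp' (L := L) (by fun_prop) (fun x z hz => by simp [hs z hz])]
  have : ∀ z, ∫ x in (0:ℝ)..1, c z * g' (x, z) = 0 := by
    intro z
    rw [intervalIntegral.integral_const_mul, intervalIntegral.integral_eq_sub_of_hasDerivAt
      (fun x _ => hd x z) (Continuous.intervalIntegrable (by fun_prop) _ _), hp z]
    simp
  simp [this]

theorem box_le {F : ℝ × ℝ → ℝ} {L : ℝ} (hL : 0 ≤ L) (hF : Continuous F) (h0 : ∀ p, 0 ≤ F p)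
    (hi : Integrable F μΩ) :
    ∫ x in (0:ℝ)..1, ∫ z in (0:ℝ)..L, F (x, z) ≤ ∫ p, F p ∂μΩ := by
  have h1 : IntegrableOn F (Ioc (0:ℝ) 1 ×ˢ Ioc (0:ℝ) L) (volume.prod volume) := by
    have : IntegrableOn F (Icc (0:ℝ) 1 ×ˢ Icc (0:ℝ) L) :=
      hF.continuousOn.integrableOn_compact (isCompact_Icc.prod isCompact_Icc)
    exact this.mono_set (prod_mono Ioc_subset_Icc_self Ioc_subset_Icc_self)
  have h2 : ∫ x in (0:ℝ)..1, ∫ z in (0:ℝ)..L, F (x, z)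
      = ∫ p in Ioc (0:ℝ) 1 ×ˢ Ioc (0:ℝ) L, F p := by
    rw [Measure.volume_eq_prod, setIntegral_prod _ h1,
      intervalIntegral.integral_of_le zero_le_one]
    simp only [intervalIntegral.integral_of_le hL]
  rw [h2, muOmega_eq]
  rw [muOmega_eq] at hi
  exact setIntegral_mono_set hi (ae_of_all _ h0)
    (LE.le.eventuallyLE (prod_mono_right Ioc_subset_Ioi_self))

theorem hardy_cmpK {f f' a g : ℝ → ℝ} {L K : ℝ} (hL : 0 ≤ L) (hK : 0 ≤ K)
    (hf : ∀ z, HasDerivAt f (f' z) z) (hf' : Continuous f') (ha : Continuous a)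
    (hg : Continuous g) (h0 : f 0 = 0)
    (hle : ∀ z, 0 < z → z < L → g z ≤ a z + K * ((f z) ^ 2 / (4 * z ^ 2))) :
    ∫ z in (0:ℝ)..L, g z ≤ ∫ z in (0:ℝ)..L, (a z + K * (f' z) ^ 2) := by
  have := hardy_cmp (f := fun z => √K * f z) (f' := fun z => √K * f' z) (a := a) (g := g) hL
    (fun z => (hf z).const_mul _) (by fun_prop) ha hg (by simp [h0]) (by
      intro z h1 h2
      have := hle z h1 h2
      rw [mul_pow, Real.sq_sqrt hK, mul_div_assoc]
      exact this)
  simpa only [mul_pow, Real.sq_sqrt hK] using this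

theorem hardyΩ {f f' a g : ℝ × ℝ → ℝ} {L K : ℝ} (hL : 0 ≤ L) (hK : 0 ≤ K)
    (hf' : Continuous f') (ha : Continuous a) (hg : Continuous g)
    (hd : ∀ x z, HasDerivAt (fun z => f (x, z)) (f' (x, z)) z)
    (h0 : ∀ x, f (x, 0) = 0) (hs : ∀ x z, L < z → g (x, z) = 0) (ha0 : ∀ p, 0 ≤ a p)
    (hle : ∀ x z, 0 < z → z < L → g (x, z) ≤ a (x, z) + K * ((f (x, z)) ^ 2 / (4 * z ^ 2)))
    (hi : Integrable (fun p => a p + K * f' p ^ 2) μΩ) :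
    ∫ p, g p ∂μΩ ≤ ∫ p, (a p + K * f' p ^ 2) ∂μΩ := by
  rw [iter_supp hL hg hs]
  refine le_trans ?_ (box_le hL (by fun_prop) (fun p => ?_) hi)
  · apply intervalIntegral.integral_mono_on zero_le_one
    · apply Continuous.intervalIntegrable
      apply intervalIntegral.continuous_parametric_intervalIntegral_of_continuous'
      simpa [Function.uncurry_def] using hg
    · apply Continuous.intervalIntegrable
      apply intervalIntegral.continuous_parametric_intervalIntegral_of_continuous'
      simp only [Function.uncurry_def]
      fun_prop
    · intro x _
      exact hardy_cmpK hL hK (fun z => hd x z) (by fun_prop) (by fun_prop) (by fun_prop) (h0 x)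
        (fun z h1 h2 => hle x z h1 h2)
  · have := ha0 p
    positivity

/-- The error term coming from the cutoff tends to zero. -/
theorem err_tendsto {f f' : ℝ × ℝ → ℝ} {c2 : ℕ → ℝ → ℝ} {C2 : ℝ} (hC2 : 0 ≤ C2)
    (hf : Continuous f) (hf' : Continuous f')
    (hd : ∀ x z, HasDerivAt (fun z => f (x, z)) (f' (x, z)) z)
    (h0 : ∀ x, f (x, 0) = 0) (hdec : ∀ x, Tendsto (fun z => f (x, z)) atTop (𝓝 0))
    (hi : Integrable (fun p => f' p ^ 2) μΩ)
    (hc : ∀ n, Continuous (c2 n)) (hs : ∀ (n : ℕ) z, 3 * ((n:ℝ) + 1) ≤ z → c2 n z = 0)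
    (hb : ∀ (n : ℕ) z, 0 ≤ z → |c2 n z| * ((n:ℝ) + 1) ^ 2 ≤ C2) :
    Tendsto (fun n => ∫ p, c2 n p.2 * f p ^ 2 ∂μΩ) atTop (𝓝 0) := by
  have hNpos : ∀ n : ℕ, (0:ℝ) < (n:ℝ) + 1 := fun n => by positivity
  have hpt : ∀ (n : ℕ) z, 0 < z → z < 3 * ((n:ℝ) + 1) → ∀ y : ℝ,
      |c2 n z * y ^ 2| ≤ 36 * C2 * (y ^ 2 / (4 * z ^ 2)) := by
    intro n z h1 h2 y
    have h3 := hb n z h1.le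
    have h4 : z ^ 2 ≤ 9 * ((n:ℝ) + 1) ^ 2 := by nlinarith [hNpos n]
    have h5 : |c2 n z| * z ^ 2 ≤ 9 * C2 := by nlinarith [abs_nonneg (c2 n z)]
    rw [abs_mul, abs_of_nonneg (sq_nonneg y)]
    have h6 : 36 * C2 * (y ^ 2 / (4 * z ^ 2)) = (9 * C2) * y ^ 2 / z ^ 2 := by
      field_simp; ring
    rw [h6, le_div_iff₀ (by positivity)]
    nlinarith [sq_nonneg y]
  have hrw : ∀ n, ∫ p, c2 n p.2 * f p ^ 2 ∂μΩ =
      ∫ x in Ioc (0:ℝ) 1, ∫ z in (0:ℝ)..3 * ((n:ℝ) + 1), c2 n z * f (x, z) ^ 2 := by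
    intro n
    have := hc n
    rw [iter_supp (L := 3 * ((n:ℝ) + 1)) (by have := hNpos n; positivity) (by fun_prop)
      (fun x z hz => by simp [hs n z hz.le]), intervalIntegral.integral_of_le zero_le_one]
  simp only [hrw]
  have hi' := hi
  rw [μΩ] at hi'
  have hz : 𝓝 (0:ℝ) = 𝓝 (∫ x in Ioc (0:ℝ) 1, (0:ℝ)) := by simp
  rw [hz]
  apply tendsto_integral_of_dominated_convergence
    (fun x => 36 * C2 * ∫ z in Ioi (0:ℝ), f' (x, z) ^ 2)
  · intro n
    apply Continuous.aestronglyMeasurable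
    apply intervalIntegral.continuous_parametric_intervalIntegral_of_continuous'
    have := hc n
    simp only [Function.uncurry_def]
    fun_prop
  · exact hi'.integral_prod_left.const_mul _
  · intro n
    filter_upwards [hi'.prod_right_ae] with x hx
    have hc' := hc n
    have hL : (0:ℝ) ≤ 3 * ((n:ℝ) + 1) := by have := hNpos n; positivity
    have h1 : ‖∫ z in (0:ℝ)..3 * ((n:ℝ) + 1), c2 n z * f (x, z) ^ 2‖ ≤
        ∫ z in (0:ℝ)..3 * ((n:ℝ) + 1), |c2 n z * f (x, z) ^ 2| := by
      exact intervalIntegral.norm_integral_le_integral_norm hL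
    have h2 := hardy_cmpK (f := fun z => f (x, z)) (f' := fun z => f' (x, z)) (a := fun _ => 0)
      (g := fun z => |c2 n z * f (x, z) ^ 2|) (K := 36 * C2) hL (by positivity)
      (fun z => hd x z) (by fun_prop) (by fun_prop) (by fun_prop) (h0 x)
      (fun z a1 a2 => by simpa using hpt n z a1 a2 (f (x, z)))
    refine h1.trans (h2.trans ?_)
    simp only [zero_add]
    rw [intervalIntegral.integral_const_mul]
    refine mul_le_mul_of_nonneg_left ?_ (by positivity)
    rw [intervalIntegral.integral_of_le hL]
    exact setIntegral_mono_set hx (ae_of_all _ fun z => sq_nonneg _)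
      (LE.le.eventuallyLE Ioc_subset_Ioi_self)
  · refine ae_of_all _ fun x => ?_
    obtain ⟨B, hB⟩ : ∃ B, ∀ z, 0 ≤ z → f (x, z) ^ 2 ≤ B := by
      have h1 : ∀ᶠ z in atTop, |f (x, z)| ≤ 1 := by
        have := (hdec x).abs
        rw [abs_zero] at this
        exact (this.eventually (gt_mem_nhds one_pos)).mono fun z hz => le_of_lt hz
      obtain ⟨Z, hZ⟩ := eventually_atTop.1 h1
      obtain ⟨C, hC⟩ := (isCompact_Icc (a := (0:ℝ)) (b := Z)).exists_bound_of_continuousOn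
        (f := fun z => f (x, z) ^ 2) (by fun_prop)
      refine ⟨max C 1, fun z hz => ?_⟩
      by_cases h : z ≤ Z
      · exact (le_abs_self _).trans ((hC z ⟨hz, h⟩).trans (le_max_left _ _))
      · refine le_trans ?_ (le_max_right _ _)
        rw [← sq_abs]
        have := hZ z (not_le.1 h).le
        have h2 := abs_nonneg (f (x, z))
        nlinarith
    have hB0 : 0 ≤ B := (sq_nonneg _).trans (hB 0 le_rfl)
    have hbound : ∀ n : ℕ, ‖∫ z in (0:ℝ)..3 * ((n:ℝ) + 1), c2 n z * f (x, z) ^ 2‖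
        ≤ 3 * C2 * B * (1 / ((n:ℝ) + 1)) := by
      intro n
      have hN := hNpos n
      have hL : (0:ℝ) ≤ 3 * ((n:ℝ) + 1) := by positivity
      have := intervalIntegral.norm_integral_le_of_norm_le_const (a := 0) (b := 3 * ((n:ℝ) + 1))
        (f := fun z => c2 n z * f (x, z) ^ 2) (C := C2 / ((n:ℝ) + 1) ^ 2 * B) (by
          intro z hz
          rw [uIoc_of_le hL] at hz
          rw [norm_mul, Real.norm_eq_abs, Real.norm_eq_abs, abs_of_nonneg (sq_nonneg (f (x, z)))]
          apply mul_le_mul _ (hB z hz.1.le) (sq_nonneg _) (by positivity)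
          rw [le_div_iff₀ (by positivity)]
          exact hb n z hz.1.le)
      refine this.trans (le_of_eq ?_)
      rw [sub_zero, abs_of_nonneg hL]
      field_simp
    refine squeeze_zero_norm hbound ?_
    have := (tendsto_one_div_add_atTop_nhds_zero_nat (𝕜 := ℝ)).const_mul (3 * C2 * B)
    simpa using this

theorem energy_id {u ut ux uz uzz b bx bz bzz w : ℝ × ℝ → ℝ} {U U' c c1 c2 : ℝ → ℝ} {κ L : ℝ}
    (hL : 0 ≤ L) (cu : Continuous u) (cut : Continuous ut) (cux : Continuous ux)
    (cuz : Continuous uz) (cuzz : Continuous uzz) (cb : Continuous b) (cbx : Continuous bx)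
    (cbz : Continuous bz) (cbzz : Continuous bzz) (cw : Continuous w) (cU : Continuous U)
    (cU' : Continuous U')
    (hux : ∀ x z, HasDerivAt (fun x => u (x, z)) (ux (x, z)) x)
    (hbx : ∀ x z, HasDerivAt (fun x => b (x, z)) (bx (x, z)) x)
    (huz : ∀ x z, HasDerivAt (fun z => u (x, z)) (uz (x, z)) z)
    (huzz : ∀ x z, HasDerivAt (fun z => uz (x, z)) (uzz (x, z)) z)
    (hbz : ∀ x z, HasDerivAt (fun z => b (x, z)) (bz (x, z)) z)
    (hbzz : ∀ x z, HasDerivAt (fun z => bz (x, z)) (bzz (x, z)) z)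
    (hup : ∀ z, u (1, z) = u (0, z)) (hbp : ∀ z, b (1, z) = b (0, z))
    (hu0 : ∀ x, u (x, 0) = 0) (hb0 : ∀ x, b (x, 0) = 0)
    (heq : ∀ x z, 0 < z → ut (x, z) + U z * ux (x, z) + w (x, z) * U' z - uzz (x, z)
      = κ * bx (x, z))
    (hcon : ∀ x z, 0 < z → ux (x, z) + bzz (x, z) = 0)
    (hc : ∀ z, HasDerivAt c (c1 z) z) (hc' : ∀ z, HasDerivAt c1 (c2 z) z) (hcc : Continuous c2)
    (hs : ∀ z, L ≤ z → c z = 0 ∧ c1 z = 0 ∧ c2 z = 0) :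
    ∫ p, c p.2 * (u p * ut p) ∂μΩ = -(∫ p, c p.2 * (uz p ^ 2 + κ * bz p ^ 2) ∂μΩ)
      - (∫ p, c p.2 * (u p * w p * U' p.2) ∂μΩ)
      + ∫ p, c2 p.2 * (u p ^ 2 + κ * b p ^ 2) / 2 ∂μΩ := by
  have c3 : Continuous c := continuous_iff_continuousAt.2 fun z => (hc z).continuousAt
  have sc : ∀ z, L < z → c z = 0 := fun z hz => (hs z hz.le).1
  have sc2 : ∀ z, L < z → c2 z = 0 := fun z hz => (hs z hz.le).2.2
  have e1 := ibp2 hL cu cuz cuzz huz huzz hu0 hc hc' hcc hs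
  have e2 := ibp2 hL cb cbz cbzz hbz hbzz hb0 hc hc' hcc hs
  have e3 := per0 (g := fun p => u p ^ 2 / 2) (g' := fun p => u p * ux p)
    (c := fun z => c z * U z) (L := L) (by fun_prop) (by fun_prop)
    (fun x z => by
      refine HasDerivAt.congr_deriv (((hux x z).pow 2).div_const 2) ?_
      simp only [Nat.cast_ofNat]; ring)
    (fun z => by simp only [hup z]) (fun z hz => by simp [sc z hz])
  have e4 := per0 (g := fun p => u p * b p) (g' := fun p => u p * bx p + ux p * b p)
    (c := c) (L := L) (by fun_prop) (by fun_prop)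
    (fun x z => by
      refine HasDerivAt.congr_deriv ((hux x z).mul (hbx x z)) ?_
      ring)
    (fun z => by simp only [hup z, hbp z]) (fun z hz => by simp [sc z hz])
  have i0 : Integrable (fun p => c p.2 * (u p * ut p)) μΩ :=
    int_supp (L := L) (by fun_prop) (fun x z hz => by simp [sc z hz])
  have i1 : Integrable (fun p => c p.2 * (u p * uzz p + uz p ^ 2)) μΩ :=
    int_supp (L := L) (by fun_prop) (fun x z hz => by simp [sc z hz])
  have i2 : Integrable (fun p => c p.2 * (b p * bzz p + bz p ^ 2)) μΩ :=
    int_supp (L := L) (by fun_prop) (fun x z hz => by simp [sc z hz])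
  have i3 : Integrable (fun p => c p.2 * U p.2 * (u p * ux p)) μΩ :=
    int_supp (L := L) (by fun_prop) (fun x z hz => by simp [sc z hz])
  have i4 : Integrable (fun p => c p.2 * (u p * bx p + ux p * b p)) μΩ :=
    int_supp (L := L) (by fun_prop) (fun x z hz => by simp [sc z hz])
  have i5 : Integrable (fun p => c p.2 * (uz p ^ 2 + κ * bz p ^ 2)) μΩ :=
    int_supp (L := L) (by fun_prop) (fun x z hz => by simp [sc z hz])
  have i6 : Integrable (fun p => c p.2 * (u p * w p * U' p.2)) μΩ :=
    int_supp (L := L) (by fun_prop) (fun x z hz => by simp [sc z hz])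
  have i7 : Integrable (fun p => c2 p.2 * u p ^ 2 / 2) μΩ :=
    int_supp (L := L) (by fun_prop) (fun x z hz => by simp [sc2 z hz])
  have i8 : Integrable (fun p => c2 p.2 * b p ^ 2 / 2) μΩ :=
    int_supp (L := L) (by fun_prop) (fun x z hz => by simp [sc2 z hz])
  have e5 : ∫ p, c2 p.2 * (u p ^ 2 + κ * b p ^ 2) / 2 ∂μΩ =
      (∫ p, c2 p.2 * u p ^ 2 / 2 ∂μΩ) + κ * ∫ p, c2 p.2 * b p ^ 2 / 2 ∂μΩ := by
    rw [← MeasureTheory.integral_const_mul, ← MeasureTheory.integral_add i7 (i8.const_mul κ)]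
    congr 1; funext p; ring
  have e6 : ∫ p, (c p.2 * (u p * ut p) + c p.2 * (uz p ^ 2 + κ * bz p ^ 2)
      + c p.2 * (u p * w p * U' p.2)) ∂μΩ = ∫ p, (c p.2 * (u p * uzz p + uz p ^ 2)
      + κ * (c p.2 * (b p * bzz p + bz p ^ 2)) - c p.2 * U p.2 * (u p * ux p)
      + κ * (c p.2 * (u p * bx p + ux p * b p))) ∂μΩ := by
    refine integral_congr_ae (ae_Omega ?_)
    intro x z _ _ hz
    have h1 := heq x z hz
    have h2 := hcon x z hz
    have h3 : ut (x, z) = κ * bx (x, z) - U z * ux (x, z) - w (x, z) * U' z + uzz (x, z) := by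
      linarith
    have h4 : bzz (x, z) = -ux (x, z) := by linarith
    simp only [h3, h4]
    ring
  have j1 : Integrable (fun p => c p.2 * (u p * ut p) + c p.2 * (uz p ^ 2 + κ * bz p ^ 2)) μΩ :=
    i0.add i5
  have j2 : Integrable (fun p => c p.2 * (u p * uzz p + uz p ^ 2)
      + κ * (c p.2 * (b p * bzz p + bz p ^ 2))) μΩ := i1.add (i2.const_mul κ)
  have j3 : Integrable (fun p => c p.2 * (u p * uzz p + uz p ^ 2)
      + κ * (c p.2 * (b p * bzz p + bz p ^ 2)) - c p.2 * U p.2 * (u p * ux p)) μΩ := j2.sub i3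
  rw [MeasureTheory.integral_add j1 i6, MeasureTheory.integral_add i0 i5,
    MeasureTheory.integral_add j3 (i4.const_mul κ),
    MeasureTheory.integral_sub j2 i3, MeasureTheory.integral_add i1 (i2.const_mul κ),
    MeasureTheory.integral_const_mul, MeasureTheory.integral_const_mul, e1, e2, e3, e4] at e6
  rw [e5]
  linarith

theorem tail_pt (κ M ε B N d uz bz u β U' : ℝ) (hκ : 0 < κ) (hε : 0 < ε) (hN : 0 < N)
    (hd0 : 0 ≤ d) (hd1 : d ≤ 1) (hβ : |β| ≤ B) (hU : |U'| * N ≤ M) :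
    -(d * (uz ^ 2 + κ * bz ^ 2)) - d * (u * (bz - β) * U')
      ≤ (M ^ 2 / (4 * κ * N ^ 2) + ε / 2) * u ^ 2 + B ^ 2 / (2 * ε) * U' ^ 2 := by
  have hU2 : U' ^ 2 ≤ M ^ 2 / N ^ 2 := by
    rw [le_div_iff₀ (by positivity), ← sq_abs, ← mul_pow]
    exact pow_le_pow_left₀ (by positivity) hU 2
  have hβ2 : β ^ 2 ≤ B ^ 2 := by
    rw [← sq_abs]; exact pow_le_pow_left₀ (abs_nonneg _) hβ 2
  have h1 : -(κ * bz ^ 2) - u * bz * U' ≤ U' ^ 2 * u ^ 2 / (4 * κ) := by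
    rw [le_div_iff₀ (by positivity)]
    nlinarith [sq_nonneg (2 * κ * bz + u * U')]
  have h2 : u * β * U' ≤ ε / 2 * u ^ 2 + β ^ 2 / (2 * ε) * U' ^ 2 := by
    have : ε / 2 * u ^ 2 + β ^ 2 / (2 * ε) * U' ^ 2 - u * β * U'
      = (ε * u - β * U') ^ 2 / (2 * ε) := by field_simp; ring
    have h3 : 0 ≤ (ε * u - β * U') ^ 2 / (2 * ε) := by positivity
    linarith
  have h3 : U' ^ 2 * u ^ 2 / (4 * κ) ≤ M ^ 2 / (4 * κ * N ^ 2) * u ^ 2 := by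
    have : M ^ 2 / (4 * κ * N ^ 2) * u ^ 2 = (M ^ 2 / N ^ 2) * u ^ 2 / (4 * κ) := by field_simp
    rw [this]
    gcongr
  have h4 : β ^ 2 / (2 * ε) * U' ^ 2 ≤ B ^ 2 / (2 * ε) * U' ^ 2 := by gcongr
  have h5 : -(uz ^ 2 + κ * bz ^ 2) - (u * (bz - β) * U') ≤
      (M ^ 2 / (4 * κ * N ^ 2) + ε / 2) * u ^ 2 + B ^ 2 / (2 * ε) * U' ^ 2 := by
    nlinarith [sq_nonneg uz]
  have h6 : 0 ≤ (M ^ 2 / (4 * κ * N ^ 2) + ε / 2) * u ^ 2 + B ^ 2 / (2 * ε) * U' ^ 2 := by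
    positivity
  calc _ = d * (-(uz ^ 2 + κ * bz ^ 2) - (u * (bz - β) * U')) := by ring
    _ ≤ d * ((M ^ 2 / (4 * κ * N ^ 2) + ε / 2) * u ^ 2 + B ^ 2 / (2 * ε) * U' ^ 2) :=
      mul_le_mul_of_nonneg_left h5 hd0
    _ ≤ _ := mul_le_of_le_one_left h6 hd1

theorem coer_pt (κ B U1 c uz bz u β U' : ℝ) (hκ : 0 < κ)
    (hd0 : 0 ≤ c) (hd1 : c ≤ 1) (hβ : |β| ≤ B) (hU : |U'| ≤ U1) :
    -(c * (uz ^ 2 + κ * bz ^ 2)) - c * (u * (bz - β) * U')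
      ≤ (U1 ^ 2 / (2 * κ) + 1 / 2) * u ^ 2 + B ^ 2 / 2 * U' ^ 2 - κ / 2 * (c * bz ^ 2) := by
  have hU2 : U' ^ 2 ≤ U1 ^ 2 := by
    rw [← sq_abs]; exact pow_le_pow_left₀ (abs_nonneg _) hU 2
  have hβ2 : β ^ 2 ≤ B ^ 2 := by
    rw [← sq_abs]; exact pow_le_pow_left₀ (abs_nonneg _) hβ 2
  have h1 : -(κ / 2 * bz ^ 2) - u * bz * U' ≤ U' ^ 2 * u ^ 2 / (2 * κ) := by
    rw [le_div_iff₀ (by positivity)]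
    nlinarith [sq_nonneg (κ * bz + u * U')]
  have h2 : u * β * U' ≤ 1 / 2 * u ^ 2 + β ^ 2 / 2 * U' ^ 2 := by
    nlinarith [sq_nonneg (u - β * U')]
  have h3 : U' ^ 2 * u ^ 2 / (2 * κ) ≤ U1 ^ 2 / (2 * κ) * u ^ 2 := by
    have : U1 ^ 2 / (2 * κ) * u ^ 2 = U1 ^ 2 * u ^ 2 / (2 * κ) := by field_simp
    rw [this]
    gcongr
  have h4 : β ^ 2 / 2 * U' ^ 2 ≤ B ^ 2 / 2 * U' ^ 2 := by gcongr
  have h5 : -(uz ^ 2 + κ / 2 * bz ^ 2) - (u * (bz - β) * U') ≤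
      (U1 ^ 2 / (2 * κ) + 1 / 2) * u ^ 2 + B ^ 2 / 2 * U' ^ 2 := by
    nlinarith [sq_nonneg uz]
  have h6 : 0 ≤ (U1 ^ 2 / (2 * κ) + 1 / 2) * u ^ 2 + B ^ 2 / 2 * U' ^ 2 := by
    positivity
  have h7 := mul_le_mul_of_nonneg_left h5 hd0
  have h8 := mul_le_of_le_one_left h6 hd1
  nlinarith

theorem cut_tendsto {f : ℝ × ℝ → ℝ} {c : ℕ → ℝ → ℝ} (hi : Integrable f μΩ)
    (hcc : ∀ n, Continuous (c n)) (h0 : ∀ n z, 0 ≤ c n z) (h1 : ∀ n z, c n z ≤ 1)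
    (hone : ∀ (n : ℕ) z, z ≤ (n:ℝ) + 1 → c n z = 1) :
    Tendsto (fun n => ∫ p, c n p.2 * f p ∂μΩ) atTop (𝓝 (∫ p, f p ∂μΩ)) := by
  apply tendsto_integral_of_dominated_convergence (fun p => ‖f p‖)
  · intro n
    have := hcc n
    exact (Continuous.aestronglyMeasurable (by fun_prop)).mul hi.aestronglyMeasurable
  · exact hi.norm
  · intro n
    refine ae_of_all _ fun p => ?_
    rw [norm_mul, Real.norm_eq_abs, abs_of_nonneg (h0 n _)]
    exact mul_le_of_le_one_left (norm_nonneg _) (h1 n _)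
  · refine ae_of_all _ fun p => ?_
    obtain ⟨k, hk⟩ := exists_nat_ge p.2
    refine tendsto_const_nhds.congr' ?_
    filter_upwards [eventually_ge_atTop k] with n hn
    have : (k:ℝ) ≤ n := by exact_mod_cast hn
    rw [hone n p.2 (by linarith), one_mul]

theorem cut_le {f : ℝ × ℝ → ℝ} {c : ℝ → ℝ} (hi : Integrable f μΩ) (hf : ∀ p, 0 ≤ f p)
    (hcc : Continuous c) (h0 : ∀ z, 0 ≤ c z) (h1 : ∀ z, c z ≤ 1) :
    ∫ p, c p.2 * f p ∂μΩ ≤ ∫ p, f p ∂μΩ := by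
  apply integral_mono_of_nonneg
  · exact ae_of_all _ fun p => mul_nonneg (h0 _) (hf p)
  · exact hi
  · exact ae_of_all _ fun p => mul_le_of_le_one_left (hf p) (h1 _)

theorem U_int {U' : ℝ → ℝ} {M : ℝ} (hU : Continuous U')
    (hz : ∀ z ∈ Ici (0:ℝ), |z * U' z| ≤ M) :
    ∃ U1, (∀ z, 0 ≤ z → |U' z| ≤ U1) ∧ Integrable (fun p : ℝ × ℝ => U' p.2 ^ 2) μΩ := by
  obtain ⟨C, hC⟩ := (isCompact_Icc (a := (0:ℝ)) (b := 1)).exists_bound_of_continuousOn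
    hU.continuousOn
  have hb : ∀ z, 0 ≤ z → |U' z| ≤ max C M := by
    intro z hz0
    by_cases h : z ≤ 1
    · exact (hC z ⟨hz0, h⟩).trans (le_max_left _ _)
    · refine le_trans ?_ (le_max_right _ _)
      have h1 := hz z hz0
      rw [abs_mul, abs_of_nonneg hz0] at h1
      nlinarith [abs_nonneg (U' z)]
  refine ⟨max C M, hb, ?_⟩
  have h1 : Integrable (fun z => U' z ^ 2) (volume.restrict (Ioi (0:ℝ))) := by
    refine Integrable.mono' ((integrable_inv_one_add_sq.restrict (s := Ioi 0)).const_mul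
      ((max C M) ^ 2 + M ^ 2)) (Continuous.aestronglyMeasurable (by fun_prop)) ?_
    refine (ae_restrict_iff' measurableSet_Ioi).2 (ae_of_all _ fun z hz0 => ?_)
    have hz0' : (0:ℝ) < z := hz0
    have h2 := hb z hz0'.le
    have h3 := hz z hz0'.le
    have h4 : U' z ^ 2 ≤ (max C M) ^ 2 := by
      rw [← sq_abs]; exact pow_le_pow_left₀ (abs_nonneg _) h2 2
    have h5 : (z * U' z) ^ 2 ≤ M ^ 2 := by
      rw [← sq_abs]; exact pow_le_pow_left₀ (abs_nonneg _) h3 2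
    rw [Real.norm_eq_abs, abs_of_nonneg (sq_nonneg _), ← div_eq_mul_inv,
      le_div_iff₀ (by positivity)]
    nlinarith
  rw [μΩ]
  exact h1.comp_snd _

theorem tail_tendsto {U' : ℝ → ℝ} (hi : Integrable (fun p : ℝ × ℝ => U' p.2 ^ 2) μΩ) :
    (∀ n : ℕ, Integrable
      (fun p : ℝ × ℝ => (Ici ((n:ℝ) + 1)).indicator (fun z => U' z ^ 2) p.2) μΩ) ∧
    Tendsto (fun n : ℕ => ∫ p : ℝ × ℝ, (Ici ((n:ℝ) + 1)).indicator (fun z => U' z ^ 2) p.2 ∂μΩ)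
      atTop (𝓝 0) := by
  have hind : ∀ n : ℕ, (fun p : ℝ × ℝ => (Ici ((n:ℝ) + 1)).indicator (fun z => U' z ^ 2) p.2) =
      (Prod.snd ⁻¹' (Ici ((n:ℝ) + 1))).indicator (fun p : ℝ × ℝ => U' p.2 ^ 2) := by
    intro n; funext p
    by_cases h : (n:ℝ) + 1 ≤ p.2 <;> simp [indicator, h]
  have hint : ∀ n : ℕ, Integrable
      (fun p : ℝ × ℝ => (Ici ((n:ℝ) + 1)).indicator (fun z => U' z ^ 2) p.2) μΩ := by
    intro n
    rw [hind n]
    exact hi.indicator (measurable_snd measurableSet_Ici)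
  refine ⟨hint, ?_⟩
  have hz : 𝓝 (0:ℝ) = 𝓝 (∫ p : ℝ × ℝ, (0:ℝ) ∂μΩ) := by simp
  rw [hz]
  apply tendsto_integral_of_dominated_convergence (fun p => U' p.2 ^ 2)
  · exact fun n => (hint n).aestronglyMeasurable
  · exact hi
  · intro n
    refine ae_of_all _ fun p => ?_
    rw [Real.norm_eq_abs, abs_of_nonneg (indicator_nonneg (fun z _ => sq_nonneg _) _)]
    exact indicator_le_self' (fun z _ => sq_nonneg _) _
  · refine ae_of_all _ fun p => ?_
    obtain ⟨k, hk⟩ := exists_nat_ge p.2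
    refine tendsto_const_nhds.congr' ?_
    filter_upwards [eventually_ge_atTop k] with n hn
    have : (k:ℝ) ≤ n := by exact_mod_cast hn
    rw [indicator_of_notMem]
    simp only [mem_Ici, not_le]
    linarith

theorem tail_int {u uz bz β : ℝ × ℝ → ℝ} {U' c d : ℝ → ℝ} {κ M ε B N L : ℝ}
    (hκ : 0 < κ) (hε : 0 < ε) (hN : 0 < N)
    (cu : Continuous u) (cuz : Continuous uz) (cbz : Continuous bz) (cβ : Continuous β)
    (cU : Continuous U') (cc : Continuous c) (cd : Continuous d)
    (hc : ∀ z, L < z → c z = 0) (hd : ∀ z, L < z → d z = 0)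
    (hc0 : ∀ z, 0 ≤ c z) (hd1 : ∀ z, d z ≤ 1) (hcd : ∀ z, 0 ≤ z → c z ≤ d z)
    (hcN : ∀ z, z ≤ N → c z = 1) (hdN : ∀ z, z ≤ N → d z = 1)
    (hβ : ∀ x z, 0 < x → x ≤ 1 → |β (x, z)| ≤ B) (hU : ∀ z ∈ Ici (0:ℝ), |z * U' z| ≤ M)
    (hi : Integrable (fun p => u p ^ 2) μΩ)
    (hτ : Integrable (fun p : ℝ × ℝ => (Ici N).indicator (fun z => U' z ^ 2) p.2) μΩ) :
    -(∫ p, d p.2 * (uz p ^ 2 + κ * bz p ^ 2) ∂μΩ)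
      - (∫ p, d p.2 * (u p * (bz p - β p) * U' p.2) ∂μΩ) ≤
    -(∫ p, c p.2 * (uz p ^ 2 + κ * bz p ^ 2) ∂μΩ)
      - (∫ p, c p.2 * (u p * (bz p - β p) * U' p.2) ∂μΩ)
      + ((M ^ 2 / (4 * κ * N ^ 2) + ε / 2) * (∫ p, u p ^ 2 ∂μΩ)
      + B ^ 2 / (2 * ε) * ∫ p : ℝ × ℝ, (Ici N).indicator (fun z => U' z ^ 2) p.2 ∂μΩ) := by
  have i1 : Integrable (fun p => d p.2 * (uz p ^ 2 + κ * bz p ^ 2)) μΩ :=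
    int_supp (L := L) (by fun_prop) (fun x z hz => by simp [hd z hz])
  have i2 : Integrable (fun p => d p.2 * (u p * (bz p - β p) * U' p.2)) μΩ :=
    int_supp (L := L) (by fun_prop) (fun x z hz => by simp [hd z hz])
  have i3 : Integrable (fun p => c p.2 * (uz p ^ 2 + κ * bz p ^ 2)) μΩ :=
    int_supp (L := L) (by fun_prop) (fun x z hz => by simp [hc z hz])
  have i4 : Integrable (fun p => c p.2 * (u p * (bz p - β p) * U' p.2)) μΩ :=
    int_supp (L := L) (by fun_prop) (fun x z hz => by simp [hc z hz])
  have i12 : Integrable (fun p => d p.2 * (uz p ^ 2 + κ * bz p ^ 2)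
    + d p.2 * (u p * (bz p - β p) * U' p.2)) μΩ := i1.add i2
  have i34 : Integrable (fun p => c p.2 * (uz p ^ 2 + κ * bz p ^ 2)
    + c p.2 * (u p * (bz p - β p) * U' p.2)) μΩ := i3.add i4
  have i5 := hi.const_mul (M ^ 2 / (4 * κ * N ^ 2) + ε / 2)
  have i6 := hτ.const_mul (B ^ 2 / (2 * ε))
  have i56 : Integrable (fun p => (M ^ 2 / (4 * κ * N ^ 2) + ε / 2) * u p ^ 2 +
    B ^ 2 / (2 * ε) * (Ici N).indicator (fun z => U' z ^ 2) p.2) μΩ := i5.add i6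
  have key : ∫ p, ((c p.2 * (uz p ^ 2 + κ * bz p ^ 2) + c p.2 * (u p * (bz p - β p) * U' p.2))
      - (d p.2 * (uz p ^ 2 + κ * bz p ^ 2) + d p.2 * (u p * (bz p - β p) * U' p.2))) ∂μΩ
      ≤ ∫ p, ((M ^ 2 / (4 * κ * N ^ 2) + ε / 2) * u p ^ 2 +
    B ^ 2 / (2 * ε) * (Ici N).indicator (fun z => U' z ^ 2) p.2) ∂μΩ := by
    refine integral_mono_ae (i34.sub i12) i56 (ae_Omega ?_)
    intro x z hx hx1 hz
    dsimp only
    by_cases h : z < N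
    · rw [hcN z h.le, hdN z h.le]
      have : 0 ≤ (Ici N).indicator (fun z => U' z ^ 2) z :=
        indicator_nonneg (fun z _ => sq_nonneg _) _
      have : 0 ≤ (M ^ 2 / (4 * κ * N ^ 2) + ε / 2) * u (x, z) ^ 2 +
        B ^ 2 / (2 * ε) * (Ici N).indicator (fun z => U' z ^ 2) z := by positivity
      linarith
    · have h' : N ≤ z := not_lt.1 h
      rw [indicator_of_mem (show z ∈ Ici N from h')]
      have hUz := hU z hz.le
      rw [abs_mul, abs_of_pos hz] at hUz
      have := tail_pt κ M ε B N (d z - c z) (uz (x, z)) (bz (x, z)) (u (x, z)) (β (x, z)) (U' z)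
        hκ hε hN (by linarith [hcd z hz.le]) (by linarith [hd1 z, hc0 z]) (hβ x z hx hx1)
        (by nlinarith [abs_nonneg (U' z)])
      linarith
  rw [MeasureTheory.integral_sub i34 i12, MeasureTheory.integral_add i1 i2,
    MeasureTheory.integral_add i3 i4, MeasureTheory.integral_add i5 i6,
    MeasureTheory.integral_const_mul, MeasureTheory.integral_const_mul] at key
  linarith

theorem coer_int {u uz bz β : ℝ × ℝ → ℝ} {U' c : ℝ → ℝ} {κ B U1 L : ℝ}
    (hκ : 0 < κ)
    (cu : Continuous u) (cuz : Continuous uz) (cbz : Continuous bz) (cβ : Continuous β)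
    (cU : Continuous U') (cc : Continuous c)
    (hc : ∀ z, L < z → c z = 0)
    (hc0 : ∀ z, 0 ≤ c z) (hc1 : ∀ z, c z ≤ 1)
    (hβ : ∀ x z, 0 < x → x ≤ 1 → |β (x, z)| ≤ B) (hU : ∀ z, 0 ≤ z → |U' z| ≤ U1)
    (hi : Integrable (fun p => u p ^ 2) μΩ)
    (hτ : Integrable (fun p : ℝ × ℝ => U' p.2 ^ 2) μΩ) :
    -(∫ p, c p.2 * (uz p ^ 2 + κ * bz p ^ 2) ∂μΩ)
      - (∫ p, c p.2 * (u p * (bz p - β p) * U' p.2) ∂μΩ) ≤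
      (U1 ^ 2 / (2 * κ) + 1 / 2) * (∫ p, u p ^ 2 ∂μΩ) + B ^ 2 / 2 * (∫ p, U' p.2 ^ 2 ∂μΩ)
      - κ / 2 * ∫ p, c p.2 * bz p ^ 2 ∂μΩ := by
  have i3 : Integrable (fun p => c p.2 * (uz p ^ 2 + κ * bz p ^ 2)) μΩ :=
    int_supp (L := L) (by fun_prop) (fun x z hz => by simp [hc z hz])
  have i4 : Integrable (fun p => c p.2 * (u p * (bz p - β p) * U' p.2)) μΩ :=
    int_supp (L := L) (by fun_prop) (fun x z hz => by simp [hc z hz])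
  have i7 : Integrable (fun p => c p.2 * bz p ^ 2) μΩ :=
    int_supp (L := L) (by fun_prop) (fun x z hz => by simp [hc z hz])
  have i8 := i7.const_mul (κ / 2)
  have i5 := hi.const_mul (U1 ^ 2 / (2 * κ) + 1 / 2)
  have i6 := hτ.const_mul (B ^ 2 / 2)
  have i56 : Integrable (fun p => (U1 ^ 2 / (2 * κ) + 1 / 2) * u p ^ 2 + B ^ 2 / 2 * U' p.2 ^ 2)
    μΩ := i5.add i6
  have j3 : Integrable (fun p => -(c p.2 * (uz p ^ 2 + κ * bz p ^ 2))) μΩ := i3.neg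
  have key : ∫ p, (-(c p.2 * (uz p ^ 2 + κ * bz p ^ 2)) - c p.2 * (u p * (bz p - β p) * U' p.2))
      ∂μΩ ≤ ∫ p, ((U1 ^ 2 / (2 * κ) + 1 / 2) * u p ^ 2 + B ^ 2 / 2 * U' p.2 ^ 2
        - κ / 2 * (c p.2 * bz p ^ 2)) ∂μΩ := by
    refine integral_mono_ae (j3.sub i4) (i56.sub i8) (ae_Omega ?_)
    intro x z hx hx1 hz
    exact coer_pt κ B U1 (c z) _ _ _ _ _ hκ (hc0 z) (hc1 z) (hβ x z hx hx1) (hU z hz.le)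
  rw [MeasureTheory.integral_sub j3 i4, MeasureTheory.integral_neg,
    MeasureTheory.integral_sub i56 i8, MeasureTheory.integral_add i5 i6,
    MeasureTheory.integral_const_mul, MeasureTheory.integral_const_mul,
    MeasureTheory.integral_const_mul] at key
  exact key

theorem err_bound {u b bz : ℝ × ℝ → ℝ} {c2 : ℝ → ℝ} {κ N C2 : ℝ} (hκ : 0 < κ) (hN : 1 ≤ N)
    (hC2 : 0 ≤ C2) (cu : Continuous u) (cb : Continuous b) (cbz : Continuous bz)
    (hd : ∀ x z, HasDerivAt (fun z => b (x, z)) (bz (x, z)) z)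
    (h0 : ∀ x, b (x, 0) = 0) (hc : Continuous c2) (hs : ∀ z, 3 * N ≤ z → c2 z = 0)
    (hb : ∀ z, 0 ≤ z → |c2 z| * N ^ 2 ≤ C2)
    (hi : Integrable (fun p => u p ^ 2) μΩ) (hib : Integrable (fun p => bz p ^ 2) μΩ) :
    |∫ p, c2 p.2 * (u p ^ 2 + κ * b p ^ 2) ∂μΩ| ≤
      C2 * (∫ p, u p ^ 2 ∂μΩ) + κ * (36 * C2) * ∫ p, bz p ^ 2 ∂μΩ := by
  have hi1 := hi.const_mul C2
  have hi2 := hib.const_mul (κ * (36 * C2))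
  have e : ∫ p, (C2 * u p ^ 2 + κ * (36 * C2) * bz p ^ 2) ∂μΩ =
      C2 * (∫ p, u p ^ 2 ∂μΩ) + κ * (36 * C2) * ∫ p, bz p ^ 2 ∂μΩ := by
    rw [MeasureTheory.integral_add hi1 hi2, MeasureTheory.integral_const_mul,
      MeasureTheory.integral_const_mul]
  rw [← e]
  refine MeasureTheory.abs_integral_le_integral_abs.trans ?_
  refine hardyΩ (f := b) (f' := bz) (a := fun p => C2 * u p ^ 2) (L := 3 * N) (by linarith)
    (by positivity) cbz (by fun_prop) (by fun_prop) hd h0 ?_ (fun p => by positivity) ?_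
    (hi1.add hi2)
  · intro x z hz
    simp [hs z hz.le]
  · intro x z hz hz1
    dsimp only
    have h1 := hb z hz.le
    have hpos := abs_nonneg (c2 z)
    rw [abs_mul, abs_of_nonneg (by positivity : 0 ≤ u (x, z) ^ 2 + κ * b (x, z) ^ 2), mul_add]
    have h2 : |c2 z| ≤ C2 := by
      refine le_trans ?_ h1
      exact le_mul_of_one_le_right hpos (one_le_pow₀ hN)
    have h4 : z ^ 2 ≤ 9 * N ^ 2 := by nlinarith
    have h5 : |c2 z| * z ^ 2 ≤ 9 * C2 := by nlinarith
    have h6 : |c2 z| * (κ * b (x, z) ^ 2) ≤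
        κ * (36 * C2) * (b (x, z) ^ 2 / (4 * z ^ 2)) := by
      have : κ * (36 * C2) * (b (x, z) ^ 2 / (4 * z ^ 2)) =
        (9 * C2 * (κ * b (x, z) ^ 2)) / z ^ 2 := by field_simp; ring
      rw [this, le_div_iff₀ (by positivity)]
      have : 0 ≤ κ * b (x, z) ^ 2 := by positivity
      nlinarith
    have h7 : |c2 z| * u (x, z) ^ 2 ≤ C2 * u (x, z) ^ 2 := by gcongr
    linarith

theorem Q_bound {u ux w bzz : ℝ × ℝ → ℝ} {U' c : ℝ → ℝ} {M L : ℝ} (hL : 0 ≤ L) (hM : 0 ≤ M)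
    (cu : Continuous u) (cw : Continuous w) (cbzz : Continuous bzz)
    (cU : Continuous U') (cc : Continuous c)
    (hd : ∀ x z, HasDerivAt (fun z => w (x, z)) (bzz (x, z)) z)
    (h0 : ∀ x, w (x, 0) = 0)
    (hcon : ∀ x z, 0 < z → ux (x, z) + bzz (x, z) = 0)
    (hc : ∀ z, L < z → c z = 0)
    (hc0 : ∀ z, 0 ≤ c z) (hc1 : ∀ z, c z ≤ 1)
    (hU : ∀ z ∈ Ici (0:ℝ), |z * U' z| ≤ M)
    (hi : Integrable (fun p => u p ^ 2) μΩ) (hix : Integrable (fun p => ux p ^ 2) μΩ) :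
    -(∫ p, c p.2 * (u p * w p * U' p.2) ∂μΩ) ≤
      M * ((∫ p, ux p ^ 2 ∂μΩ) + ∫ p, u p ^ 2 ∂μΩ) := by
  have hae : (fun p => ux p ^ 2) =ᵐ[μΩ] fun p => bzz p ^ 2 := by
    refine ae_Omega ?_
    intro x z _ _ hz
    have := hcon x z hz
    have : ux (x, z) = - bzz (x, z) := by linarith
    simp [this]
  have hib : Integrable (fun p => bzz p ^ 2) μΩ := hix.congr hae
  have hi1 := hi.const_mul M
  have hi2 := hib.const_mul M
  have e : ∫ p, (M * u p ^ 2 + M * bzz p ^ 2) ∂μΩ =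
      M * ((∫ p, ux p ^ 2 ∂μΩ) + ∫ p, u p ^ 2 ∂μΩ) := by
    rw [MeasureTheory.integral_add hi1 hi2, MeasureTheory.integral_const_mul,
      MeasureTheory.integral_const_mul, integral_congr_ae hae]
    ring
  rw [← e, ← MeasureTheory.integral_neg]
  refine hardyΩ (f := w) (f' := bzz) (a := fun p => M * u p ^ 2) hL hM cbzz (by fun_prop)
    (by fun_prop) hd h0 ?_ (fun p => by positivity) ?_ (hi1.add hi2)
  · intro x z hz
    simp [hc z hz]
  · intro x z hz hz1
    dsimp only
    have h1 := hU z hz.le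
    rw [abs_mul, abs_of_pos hz] at h1
    set a := u (x, z)
    set y := w (x, z) / z with hy
    have hw : w (x, z) = y * z := by rw [hy]; field_simp
    have h2 : w (x, z) ^ 2 / (4 * z ^ 2) = y ^ 2 / 4 := by rw [hw]; field_simp
    rw [h2, hw]
    have h3 : |a * y| ≤ a ^ 2 + y ^ 2 / 4 := by
      rw [abs_le]; constructor <;> nlinarith [sq_nonneg (a - y / 2), sq_nonneg (a + y / 2)]
    calc -(c z * (a * (y * z) * U' z)) ≤ |c z * (a * (y * z) * U' z)| := neg_le_abs _
      _ = c z * (|a * y| * (z * |U' z|)) := by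
        rw [abs_mul, abs_of_nonneg (hc0 z)]
        congr 1
        rw [show a * (y * z) * U' z = (a * y) * (z * U' z) by ring, abs_mul, abs_mul z,
          abs_of_pos hz]
      _ ≤ 1 * (|a * y| * (z * |U' z|)) := by
        gcongr
        exact hc1 z
      _ ≤ (a ^ 2 + y ^ 2 / 4) * M := by rw [one_mul]; gcongr
      _ = _ := by ring

theorem key_eps {u ut ux uz uzz b bx bz bzz : ℝ × ℝ × ℝ → ℝ} {U U' : ℝ → ℝ}
    {κ M ε B E0 α β U1 C2 : ℝ} {c c1 c2 : ℕ → ℝ → ℝ}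
    (hκ : 0 < κ) (hε : 0 < ε) (hE0 : 0 ≤ E0)
    (cu : Continuous u) (cut : Continuous ut) (cux : Continuous ux)
    (cuz : Continuous uz) (cuzz : Continuous uzz) (cb : Continuous b) (cbx : Continuous bx)
    (cbz : Continuous bz) (cbzz : Continuous bzz) (cU : Continuous U)
    (cU' : Continuous U')
    (hut : ∀ t x z, HasDerivAt (fun t => u (t, x, z)) (ut (t, x, z)) t)
    (hux : ∀ t x z, HasDerivAt (fun x => u (t, x, z)) (ux (t, x, z)) x)
    (hbx : ∀ t x z, HasDerivAt (fun x => b (t, x, z)) (bx (t, x, z)) x)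
    (huz : ∀ t x z, HasDerivAt (fun z => u (t, x, z)) (uz (t, x, z)) z)
    (huzz : ∀ t x z, HasDerivAt (fun z => uz (t, x, z)) (uzz (t, x, z)) z)
    (hbz : ∀ t x z, HasDerivAt (fun z => b (t, x, z)) (bz (t, x, z)) z)
    (hbzz : ∀ t x z, HasDerivAt (fun z => bz (t, x, z)) (bzz (t, x, z)) z)
    (hup : ∀ t z, u (t, 1, z) = u (t, 0, z)) (hbp : ∀ t z, b (t, 1, z) = b (t, 0, z))
    (hu0 : ∀ t x, u (t, x, 0) = 0) (hb0 : ∀ t x, b (t, x, 0) = 0)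
    (hudec : ∀ t x, Tendsto (fun z => u (t, x, z)) atTop (𝓝 0))
    (hbdec : ∀ t x, Tendsto (fun z => b (t, x, z)) atTop (𝓝 0))
    (heq : ∀ t ∈ Ioo α β, ∀ x z, 0 < z → ut (t, x, z) + U z * ux (t, x, z)
      + (bz (t, x, z) - bz (t, x, 0)) * U' z - uzz (t, x, z) = κ * bx (t, x, z))
    (hcon : ∀ t ∈ Ioo α β, ∀ x z, 0 < z → ux (t, x, z) + bzz (t, x, z) = 0)
    (hzU : ∀ z ∈ Ici (0:ℝ), |z * U' z| ≤ M)
    (hU1 : ∀ z, 0 ≤ z → |U' z| ≤ U1)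
    (hUi : Integrable (fun p : ℝ × ℝ => U' p.2 ^ 2) μΩ)
    (hiu : ∀ t ∈ Ioo α β, Integrable (fun p => u (t, p) ^ 2) μΩ)
    (hiuz : ∀ t ∈ Ioo α β, Integrable (fun p => uz (t, p) ^ 2) μΩ)
    (hibz : ∀ t ∈ Ioo α β, Integrable (fun p => bz (t, p) ^ 2) μΩ)
    (hE : ∀ t ∈ Ioo α β, DifferentiableAt ℝ (fun s => ∫ p, u (s, p) ^ 2 ∂μΩ) t)
    (hEb : ∀ t ∈ Ioo α β, ∫ p, u (t, p) ^ 2 ∂μΩ ≤ E0)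
    (hB : ∀ t ∈ Ioo α β, ∀ x, 0 < x → x ≤ 1 → |bz (t, x, 0)| ≤ B)
    (hC2 : 0 ≤ C2)
    (hc : ∀ n z, HasDerivAt (c n) (c1 n z) z) (hc' : ∀ n z, HasDerivAt (c1 n) (c2 n z) z)
    (hcc2 : ∀ n, Continuous (c2 n)) (hc0 : ∀ n z, 0 ≤ c n z) (hc1 : ∀ n z, c n z ≤ 1)
    (hone : ∀ (n : ℕ) z, z ≤ (n:ℝ) + 1 → c n z = 1)
    (hs : ∀ (n : ℕ) z, 3 * ((n:ℝ) + 1) ≤ z → c n z = 0 ∧ c1 n z = 0 ∧ c2 n z = 0)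
    (hmono : ∀ m n, m ≤ n → ∀ z, 0 ≤ z → c m z ≤ c n z)
    (hc2b : ∀ (n : ℕ) z, 0 ≤ z → |c2 n z| * ((n:ℝ) + 1) ^ 2 ≤ C2) :
    ∀ s ∈ Ioo α β, ∀ m : ℕ, deriv (fun s => ∫ p, u (s, p) ^ 2 ∂μΩ) s ≤
      2 * (-(∫ p, c m p.2 * (uz (s, p) ^ 2 + κ * bz (s, p) ^ 2) ∂μΩ)
        - (∫ p, c m p.2 * (u (s, p) * (bz (s, p) - bz (s, p.1, 0)) * U' p.2) ∂μΩ)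
        + ((M ^ 2 / (4 * κ * ((m:ℝ) + 1) ^ 2) + ε / 2) * E0 + B ^ 2 / (2 * ε) *
          ∫ p : ℝ × ℝ, (Ici ((m:ℝ) + 1)).indicator (fun z => U' z ^ 2) p.2 ∂μΩ)) := by
  have ccc : ∀ n, Continuous (c n) :=
    fun n => continuous_iff_continuousAt.2 fun z => (hc n z).continuousAt
  have sc : ∀ (n : ℕ) z, 3 * ((n:ℝ) + 1) < z → c n z = 0 := fun n z hz => (hs n z hz.le).1
  have sc2 : ∀ (n : ℕ) z, 3 * ((n:ℝ) + 1) < z → c2 n z = 0 := fun n z hz => (hs n z hz.le).2.2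
  have hLn : ∀ n : ℕ, (0:ℝ) ≤ 3 * ((n:ℝ) + 1) := fun n => by positivity
  obtain ⟨hτi, -⟩ := tail_tendsto hUi
  have hτle : ∀ m : ℕ, ∫ p : ℝ × ℝ, (Ici ((m:ℝ) + 1)).indicator (fun z => U' z ^ 2) p.2 ∂μΩ
      ≤ ∫ p : ℝ × ℝ, U' p.2 ^ 2 ∂μΩ := fun m =>
    MeasureTheory.integral_mono (hτi m) hUi
      fun p => indicator_le_self' (fun z _ => sq_nonneg _) _
  set τ := ∫ p : ℝ × ℝ, U' p.2 ^ 2 ∂μΩ with hτ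
  have hN : ∀ m : ℕ, (1:ℝ) ≤ (m:ℝ) + 1 := fun m => by
    have : (0:ℝ) ≤ m := by positivity
    linarith
  refine abs_main α β (fun s => ∫ p, u (s, p) ^ 2 ∂μΩ) hE
    (fun n s => ∫ p, c n p.2 * u (s, p) ^ 2 ∂μΩ)
    (fun n s => ∫ p, 2 * (c n p.2 * (u (s, p) * ut (s, p))) ∂μΩ)
    (fun n s => ∫ p, c2 n p.2 * (u (s, p) ^ 2 + κ * b (s, p) ^ 2) ∂μΩ)
    (fun m s => 2 * (-(∫ p, c m p.2 * (uz (s, p) ^ 2 + κ * bz (s, p) ^ 2) ∂μΩ)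
        - (∫ p, c m p.2 * (u (s, p) * (bz (s, p) - bz (s, p.1, 0)) * U' p.2) ∂μΩ)
        + ((M ^ 2 / (4 * κ * ((m:ℝ) + 1) ^ 2) + ε / 2) * E0 + B ^ 2 / (2 * ε) *
          ∫ p : ℝ × ℝ, (Ici ((m:ℝ) + 1)).indicator (fun z => U' z ^ 2) p.2 ∂μΩ)))
    (fun m s => ∫ p, c m p.2 * bz (s, p) ^ 2 ∂μΩ)
    (fun s => ∫ p, bz (s, p) ^ 2 ∂μΩ)
    (C2 * E0 + κ * (36 * C2))
    (2 * ((U1 ^ 2 / (2 * κ) + 1 / 2) * E0 + B ^ 2 / 2 * τ)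
      + 2 * ((M ^ 2 / (4 * κ) + ε / 2) * E0 + B ^ 2 / (2 * ε) * τ)) κ hκ
    ?_ ?_ ?_ ?_ ?_ ?_ ?_ ?_ ?_ ?_ ?_ ?_ ?_
  · intro s hs'
    exact cut_tendsto (hiu s hs') ccc hc0 hc1 hone
  · intro n x y _ _ _
    have := ccc n
    refine ftc_param (F := fun q => c n q.2.2 * u q ^ 2)
      (F' := fun q => 2 * (c n q.2.2 * (u q * ut q))) (L := 3 * ((n:ℝ) + 1))
      (by fun_prop) (by fun_prop) ?_ ?_ ?_ x y
    · intro s x z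
      refine HasDerivAt.congr_deriv (((hut s x z).pow 2).const_mul (c n z)) ?_
      simp only [Nat.cast_ofNat]; ring
    · intro s x z hz; simp [sc n z hz]
    · intro s x z hz; simp [sc n z hz]
  · intro m n hmn s hs'
    have e := energy_id (u := fun p => u (s, p)) (ut := fun p => ut (s, p))
      (ux := fun p => ux (s, p)) (uz := fun p => uz (s, p)) (uzz := fun p => uzz (s, p))
      (b := fun p => b (s, p)) (bx := fun p => bx (s, p)) (bz := fun p => bz (s, p))
      (bzz := fun p => bzz (s, p)) (w := fun p => bz (s, p) - bz (s, p.1, 0)) (U := U)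
      (U' := U') (c := c n) (c1 := c1 n) (c2 := c2 n) (κ := κ) (hLn n) (by fun_prop) (by fun_prop)
      (by fun_prop) (by fun_prop) (by fun_prop) (by fun_prop) (by fun_prop) (by fun_prop)
      (by fun_prop) (by fun_prop) cU cU' (hux s) (hbx s) (huz s) (huzz s) (hbz s) (hbzz s)
      (hup s) (hbp s) (hu0 s) (hb0 s) (heq s hs') (hcon s hs') (hc n) (hc' n) (hcc2 n) (hs n)
    have hLmn : 3 * ((m:ℝ) + 1) ≤ 3 * ((n:ℝ) + 1) := by
      have : (m:ℝ) ≤ n := by exact_mod_cast hmn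
      linarith
    have t := tail_int (u := fun p => u (s, p)) (uz := fun p => uz (s, p))
      (bz := fun p => bz (s, p)) (β := fun p => bz (s, p.1, 0)) (U' := U') (c := c m) (d := c n)
      (κ := κ) (M := M) (ε := ε) (B := B) (N := (m:ℝ) + 1) (L := 3 * ((n:ℝ) + 1)) hκ hε
      (by positivity) (by fun_prop) (by fun_prop) (by fun_prop) (by fun_prop) cU' (ccc m) (ccc n)
      (fun z hz => sc m z (by linarith)) (sc n) (hc0 m) (hc1 n) (hmono m n hmn) (hone m)
      (fun z hz => hone n z (by linarith)) (fun x z hx hx1 => hB s hs' x hx hx1) hzU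
      (hiu s hs') (hτi m)
    have h1 : (M ^ 2 / (4 * κ * ((m:ℝ) + 1) ^ 2) + ε / 2) * (∫ p, u (s, p) ^ 2 ∂μΩ)
      ≤ (M ^ 2 / (4 * κ * ((m:ℝ) + 1) ^ 2) + ε / 2) * E0 :=
      mul_le_mul_of_nonneg_left (hEb s hs') (by positivity)
    rw [MeasureTheory.integral_const_mul, e]
    have e2 : ∫ p, c2 n p.2 * (u (s, p) ^ 2 + κ * b (s, p) ^ 2) / 2 ∂μΩ
      = (∫ p, c2 n p.2 * (u (s, p) ^ 2 + κ * b (s, p) ^ 2) ∂μΩ) / 2 :=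
      MeasureTheory.integral_div _ _
    rw [e2]
    linarith
  · intro n
    have := ccc n
    exact cont_param (F := fun q => 2 * (c n q.2.2 * (u q * ut q))) (hLn n) (by fun_prop)
      (fun s x z hz => by simp [sc n z hz])
  · intro n
    have := hcc2 n
    exact cont_param (F := fun q => c2 n q.2.2 * (u q ^ 2 + κ * b q ^ 2)) (hLn n) (by fun_prop)
      (fun s x z hz => by simp [sc2 n z hz])
  · intro n
    have := ccc n
    have h1 := cont_param (F := fun q => c n q.2.2 * (uz q ^ 2 + κ * bz q ^ 2)) (hLn n)
      (by fun_prop) (fun s x z hz => by simp [sc n z hz])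
    have h2 := cont_param (F := fun q => c n q.2.2 * (u q * (bz q - bz (q.1, q.2.1, 0)) * U' q.2.2))
      (hLn n) (by fun_prop) (fun s x z hz => by simp [sc n z hz])
    exact ((h1.neg.sub h2).add continuous_const).const_mul 2
  · intro n
    have := ccc n
    exact cont_param (F := fun q => c n q.2.2 * bz q ^ 2) (hLn n) (by fun_prop)
      (fun s x z hz => by simp [sc n z hz])
  · intro s hs'
    have h1 := err_tendsto (f := fun p => u (s, p)) (f' := fun p => uz (s, p)) hC2 (by fun_prop)
      (by fun_prop) (huz s) (hu0 s) (hudec s) (hiuz s hs') hcc2 (fun n z hz => (hs n z hz).2.2) hc2b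
    have h2 := err_tendsto (f := fun p => b (s, p)) (f' := fun p => bz (s, p)) hC2 (by fun_prop)
      (by fun_prop) (hbz s) (hb0 s) (hbdec s) (hibz s hs') hcc2 (fun n z hz => (hs n z hz).2.2) hc2b
    have h3 := h1.add (h2.const_mul κ)
    simp only [mul_zero, add_zero] at h3
    refine h3.congr fun n => ?_
    have := hcc2 n
    have i1 : Integrable (fun p : ℝ × ℝ => c2 n p.2 * u (s, p) ^ 2) μΩ :=
      int_supp (L := 3 * ((n:ℝ) + 1)) (by fun_prop) (fun x z hz => by simp [sc2 n z hz])
    have i2 : Integrable (fun p : ℝ × ℝ => c2 n p.2 * b (s, p) ^ 2) μΩ :=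
      int_supp (L := 3 * ((n:ℝ) + 1)) (by fun_prop) (fun x z hz => by simp [sc2 n z hz])
    rw [← MeasureTheory.integral_const_mul, ← MeasureTheory.integral_add i1 (i2.const_mul κ)]
    congr 1; funext p; ring
  · intro n s hs'
    have h := err_bound (u := fun p => u (s, p)) (b := fun p => b (s, p))
      (bz := fun p => bz (s, p)) hκ (hN n) hC2 (by fun_prop) (by fun_prop) (by fun_prop) (hbz s)
      (hb0 s) (hcc2 n) (fun z hz => (hs n z hz).2.2) (hc2b n) (hiu s hs') (hibz s hs')
    refine h.trans ?_
    have hD : 0 ≤ ∫ p, bz (s, p) ^ 2 ∂μΩ := MeasureTheory.integral_nonneg fun p => sq_nonneg _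
    have h1 := mul_le_mul_of_nonneg_left (hEb s hs') hC2
    have h2 : 0 ≤ C2 * E0 * ∫ p, bz (s, p) ^ 2 ∂μΩ := by positivity
    have h3 : 0 ≤ κ * (36 * C2) := by positivity
    linarith
  · intro n s
    exact MeasureTheory.integral_nonneg fun p => mul_nonneg (hc0 n _) (sq_nonneg _)
  · intro n s hs'
    exact cut_le (hibz s hs') (fun p => sq_nonneg _) (ccc n) (hc0 n) (hc1 n)
  · intro s hs'
    exact cut_tendsto (hibz s hs') ccc hc0 hc1 hone
  · intro m s hs'
    have t := coer_int (u := fun p => u (s, p)) (uz := fun p => uz (s, p))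
      (bz := fun p => bz (s, p)) (β := fun p => bz (s, p.1, 0)) (U' := U') (c := c m)
      (κ := κ) (B := B) (U1 := U1) hκ (by fun_prop) (by fun_prop) (by fun_prop) (by fun_prop) cU'
      (ccc m) (sc m) (hc0 m) (hc1 m) (fun x z hx hx1 => hB s hs' x hx hx1) hU1 (hiu s hs') hUi
    have h1 : (U1 ^ 2 / (2 * κ) + 1 / 2) * (∫ p, u (s, p) ^ 2 ∂μΩ)
      ≤ (U1 ^ 2 / (2 * κ) + 1 / 2) * E0 := mul_le_mul_of_nonneg_left (hEb s hs') (by positivity)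
    have h2 : B ^ 2 / (2 * ε) * (∫ p : ℝ × ℝ, (Ici ((m:ℝ) + 1)).indicator (fun z => U' z ^ 2) p.2
      ∂μΩ) ≤ B ^ 2 / (2 * ε) * τ := mul_le_mul_of_nonneg_left (hτle m) (by positivity)
    have h3 : (M ^ 2 / (4 * κ * ((m:ℝ) + 1) ^ 2) + ε / 2) * E0 ≤ (M ^ 2 / (4 * κ) + ε / 2) * E0 := by
      refine mul_le_mul_of_nonneg_right ?_ hE0
      have : M ^ 2 / (4 * κ * ((m:ℝ) + 1) ^ 2) ≤ M ^ 2 / (4 * κ) := by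
        apply div_le_div_of_nonneg_left (sq_nonneg _) (by positivity)
        exact le_mul_of_one_le_right (by positivity) (one_le_pow₀ (hN m))
      linarith
    linarith

/-- the L² energy estimate for the linearized Prandtl/Shercliff system
`∂_t u + U ∂_x u + v U' - ∂²_z u = κ ∂_x b`, `∂_x u + ∂²_z b = 0`,
`v = -∫₀^z ∂_x u`, with `u = b = 0` at `z = 0` and decay at infinity:
`(1/2) (d/dt)‖u‖² + ‖∂_z u‖² + κ‖∂_z b‖² ≤ ‖zU'‖_∞ (‖∂_x u‖² + ‖u‖²)`. -/
theorem stmt_9 (T κ : ℝ) (hT : 0 < T) (hκ : 0 < κ)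
    (u b v : ℝ → ℝ → ℝ → ℝ) (U : ℝ → ℝ) (M : ℝ)
    (hu : ContDiff ℝ (⊤ : ℕ∞) (fun p : ℝ × ℝ × ℝ => u p.1 p.2.1 p.2.2))
    (hb : ContDiff ℝ (⊤ : ℕ∞) (fun p : ℝ × ℝ × ℝ => b p.1 p.2.1 p.2.2))
    (hU : ContDiff ℝ (⊤ : ℕ∞) U)
    (hup : ∀ t z, Function.Periodic (fun x => u t x z) 1)
    (hbp : ∀ t z, Function.Periodic (fun x => b t x z) 1)
    (hv : ∀ t x z, v t x z = -∫ s in (0:ℝ)..z, dX (u t) x s)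
    (hu0 : ∀ t x, u t x 0 = 0) (hb0 : ∀ t x, b t x 0 = 0)
    (hudec : ∀ t x, Tendsto (fun z => u t x z) atTop (𝓝 0))
    (hbdec : ∀ t x, Tendsto (fun z => b t x z) atTop (𝓝 0))
    (hu'dec : ∀ t x, Tendsto (fun z => dZ (u t) x z) atTop (𝓝 0))
    (hb'dec : ∀ t x, Tendsto (fun z => dZ (b t) x z) atTop (𝓝 0))
    (heq : ∀ t ∈ Ioo 0 T, ∀ (x : ℝ), ∀ z ∈ Ioi (0:ℝ),
        deriv (fun s => u s x z) t + U z * dX (u t) x z + v t x z * deriv U z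
          - dZ (dZ (u t)) x z = κ * dX (b t) x z)
    (hconstraint : ∀ t ∈ Ioo 0 T, ∀ (x : ℝ), ∀ z ∈ Ioi (0:ℝ),
        dX (u t) x z + dZ (dZ (b t)) x z = 0)
    (hM : 0 ≤ M) (hzU' : ∀ z ∈ Ici (0:ℝ), |z * deriv U z| ≤ M)
    (hint : ∀ t ∈ Icc 0 T,
        Integrable (fun p : ℝ × ℝ => (u t p.1 p.2)^2) μΩ ∧
        Integrable (fun p : ℝ × ℝ => (dX (u t) p.1 p.2)^2) μΩ ∧
        Integrable (fun p : ℝ × ℝ => (dZ (u t) p.1 p.2)^2) μΩ ∧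
        Integrable (fun p : ℝ × ℝ => (dZ (b t) p.1 p.2)^2) μΩ)
    (hEdiff : DifferentiableOn ℝ (fun s => sqL2 (u s)) (Ioo 0 T)) :
    ∀ t ∈ Ioo 0 T,
      (1/2) * deriv (fun s => sqL2 (u s)) t
        + sqL2 (dZ (u t)) + κ * sqL2 (dZ (b t))
        ≤ M * (sqL2 (dX (u t)) + sqL2 (u t)) := by
  intro t ht
  obtain ⟨c, c1, c2, C2, hC2, hc, hc', hcc2, hc0, hc1, hone, hs, hmono, hc2b⟩ := exists_cutoff
  have ccc : ∀ n, Continuous (c n) :=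
    fun n => continuous_iff_continuousAt.2 fun z => (hc n z).continuousAt
  have cU' : Continuous (deriv U) := hU.continuous_deriv (by simp)
  obtain ⟨U1, hU1, hUi⟩ := U_int cU' hzU'
  have suz := sm_Z hu
  have sbz := sm_Z hb
  have suzz := sm_Z (f := fun t => dZ (u t)) suz
  have sbzz := sm_Z (f := fun t => dZ (b t)) sbz
  have sux := sm_X hu
  have sbx := sm_X hb
  have sut := sm_T hu
  have hvw : ∀ t ∈ Ioo 0 T, ∀ x z, 0 < z → v t x z = dZ (b t) x z - dZ (b t) x 0 := by
    intro t ht x z hz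
    have cbzz : Continuous (fun s => dZ (dZ (b t)) x s) :=
      sbzz.continuous.comp (by fun_prop : Continuous fun s : ℝ => (t, x, s))
    rw [hv, ← intervalIntegral.integral_eq_sub_of_hasDerivAt (fun s _ => hd_Z (f := fun t => dZ (b t)) sbz t x s)
      (cbzz.intervalIntegrable _ _), ← intervalIntegral.integral_neg]
    refine intervalIntegral.integral_congr_ae (ae_of_all _ fun s hs => ?_)
    rw [uIoc_of_le hz.le] at hs
    have := hconstraint t ht x s hs.1
    linarith
  set α := t / 2 with hα
  set β := (t + T) / 2 with hβ
  have hsub : Icc α β ⊆ Ioo 0 T := fun s hs =>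
    ⟨by linarith [hs.1, ht.1], by linarith [hs.2, ht.2]⟩
  have hsub' : Ioo α β ⊆ Ioo 0 T := Ioo_subset_Icc_self.trans hsub
  have htm : t ∈ Ioo α β := ⟨by linarith [ht.1], by linarith [ht.2]⟩
  obtain ⟨E0, hE0⟩ := (isCompact_Icc (a := α) (b := β)).exists_bound_of_continuousOn
    (hEdiff.continuousOn.mono hsub)
  have hE0' : ∀ s ∈ Icc α β, sqL2 (u s) ≤ E0 := fun s hs => (le_abs_self _).trans (hE0 s hs)
  have hE0n : 0 ≤ E0 := (norm_nonneg _).trans (hE0 t (Ioo_subset_Icc_self htm))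
  have cβ : Continuous (fun q : ℝ × ℝ => dZ (b q.1) q.2 0) :=
    sbz.continuous.comp (by fun_prop : Continuous fun q : ℝ × ℝ => (q.1, q.2, (0:ℝ)))
  obtain ⟨B, hB⟩ := ((isCompact_Icc (a := α) (b := β)).prod
    (isCompact_Icc (a := (0:ℝ)) (b := 1))).exists_bound_of_continuousOn cβ.continuousOn
  have hI : ∀ s ∈ Ioo α β, s ∈ Icc 0 T := fun s hs => Ioo_subset_Icc_self (hsub' hs)
  have key : ∀ ε : ℝ, 0 < ε → ∀ m : ℕ, _ := fun ε hε m => key_eps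
    (u := fun p => u p.1 p.2.1 p.2.2) (b := fun p => b p.1 p.2.1 p.2.2) (U := U) (U' := deriv U)
    (κ := κ) (M := M) (ε := ε) (B := B) (E0 := E0) (α := α) (β := β) (U1 := U1)
    hκ hε hE0n hu.continuous sut.continuous sux.continuous suz.continuous suzz.continuous
    hb.continuous sbx.continuous sbz.continuous sbzz.continuous hU.continuous cU'
    (hd_T hu) (hd_X hu) (hd_X hb) (hd_Z hu) (hd_Z (f := fun t => dZ (u t)) suz) (hd_Z hb) (hd_Z (f := fun t => dZ (b t)) sbz)
    (fun t z => by simpa using hup t z 0) (fun t z => by simpa using hbp t z 0) hu0 hb0 hudec hbdec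
    (fun t ht x z hz => by
      have := heq t (hsub' ht) x z hz
      rw [hvw t (hsub' ht) x z hz] at this
      exact this)
    (fun t ht x z hz => hconstraint t (hsub' ht) x z hz) hzU' hU1 hUi
    (fun s hs => (hint s (hI s hs)).1) (fun s hs => (hint s (hI s hs)).2.2.1)
    (fun s hs => (hint s (hI s hs)).2.2.2)
    (fun s hs => (hEdiff s (hsub' hs)).differentiableAt (isOpen_Ioo.mem_nhds (hsub' hs)))
    (fun s hs => hE0' s (Ioo_subset_Icc_self hs))
    (fun s hs x hx hx1 => hB (s, x) ⟨Ioo_subset_Icc_self hs, hx.le, hx1⟩)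
    hC2 hc hc' hcc2 hc0 hc1 hone hs hmono hc2b t htm m
  obtain ⟨iu, iux, iuz, ibz⟩ := hint t (Ioo_subset_Icc_self ht)
  have hq : ∀ m : ℕ, -(∫ p, c m p.2 * (u t p.1 p.2 * (dZ (b t) p.1 p.2 - dZ (b t) p.1 0)
      * deriv U p.2) ∂μΩ) ≤ M * (sqL2 (dX (u t)) + sqL2 (u t)) := by
    intro m
    have ct : ∀ {f : ℝ → ℝ → ℝ → ℝ},
        ContDiff ℝ (⊤ : ℕ∞) (fun p : ℝ × ℝ × ℝ => f p.1 p.2.1 p.2.2) →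
        Continuous (fun p : ℝ × ℝ => f t p.1 p.2) := fun {f} hf =>
      hf.continuous.comp (by fun_prop : Continuous fun p : ℝ × ℝ => (t, p.1, p.2))
    have cbt : Continuous (fun p : ℝ × ℝ => dZ (b t) p.1 0) :=
      sbz.continuous.comp (by fun_prop : Continuous fun p : ℝ × ℝ => (t, p.1, (0:ℝ)))
    exact Q_bound (u := fun p => u t p.1 p.2) (ux := fun p => dX (u t) p.1 p.2)
      (w := fun p => dZ (b t) p.1 p.2 - dZ (b t) p.1 0)
      (bzz := fun p => dZ (dZ (b t)) p.1 p.2) (L := 3 * ((m:ℝ) + 1)) (by positivity) hM (ct hu)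
      ((ct (f := fun t => dZ (b t)) sbz).sub cbt) (ct (f := fun t => dZ (dZ (b t))) sbzz) cU' (ccc m)
      (fun x z => (hd_Z (f := fun t => dZ (b t)) sbz t x z).sub_const (dZ (b t) x 0)) (fun x => by simp)
      (fun x z hz => hconstraint t ht x z hz) (fun z hz => (hs m z hz.le).1) (hc0 m) (hc1 m)
      hzU' iu iux
  have ip : Integrable (fun p : ℝ × ℝ => dZ (u t) p.1 p.2 ^ 2 + κ * dZ (b t) p.1 p.2 ^ 2) μΩ :=
    iuz.add (ibz.const_mul κ)
  have hP := cut_tendsto ip ccc hc0 hc1 hone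
  have eP : ∫ p : ℝ × ℝ, (dZ (u t) p.1 p.2 ^ 2 + κ * dZ (b t) p.1 p.2 ^ 2) ∂μΩ
      = sqL2 (dZ (u t)) + κ * sqL2 (dZ (b t)) := by
    rw [MeasureTheory.integral_add iuz (ibz.const_mul κ), MeasureTheory.integral_const_mul]
    rfl
  rw [eP] at hP
  obtain ⟨-, hτ⟩ := tail_tendsto hUi
  have hm : Tendsto (fun m : ℕ => M ^ 2 / (4 * κ * ((m:ℝ) + 1) ^ 2)) atTop (𝓝 0) := by
    have h1 := (tendsto_one_div_add_atTop_nhds_zero_nat (𝕜 := ℝ)).pow 2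
    have h2 := h1.const_mul (M ^ 2 / (4 * κ))
    simp only [ne_eq, OfNat.ofNat_ne_zero, not_false_eq_true, zero_pow, mul_zero] at h2
    refine h2.congr fun m => ?_
    field_simp
  have hlim : ∀ ε > 0, (1/2) * deriv (fun s => sqL2 (u s)) t ≤
      -(sqL2 (dZ (u t)) + κ * sqL2 (dZ (b t))) + M * (sqL2 (dX (u t)) + sqL2 (u t))
        + ((0 + ε / 2) * E0 + B ^ 2 / (2 * ε) * 0) := by
    intro ε hε
    have hl := (hP.neg.add_const (M * (sqL2 (dX (u t)) + sqL2 (u t)))).add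
      (((hm.add_const (ε / 2)).mul_const E0).add (hτ.const_mul (B ^ 2 / (2 * ε))))
    refine ge_of_tendsto' hl fun m => ?_
    have h1 := key ε hε m
    have h2 := hq m
    change deriv (fun s => sqL2 (u s)) t ≤ _ at h1
    dsimp only at h1
    linarith
  have hl2 : Tendsto (fun ε : ℝ => -(sqL2 (dZ (u t)) + κ * sqL2 (dZ (b t)))
      + M * (sqL2 (dX (u t)) + sqL2 (u t)) + (ε / 2) * E0) (𝓝[>] 0)
      (𝓝 (-(sqL2 (dZ (u t)) + κ * sqL2 (dZ (b t)))
      + M * (sqL2 (dX (u t)) + sqL2 (u t)) + (0 / 2) * E0)) :=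
    (Continuous.tendsto (by fun_prop) 0).mono_left nhdsWithin_le_nhds
  have hfin := ge_of_tendsto hl2 (b := (1/2) * deriv (fun s => sqL2 (u s)) t) (by
    filter_upwards [self_mem_nhdsWithin] with ε hε
    have := hlim ε hε
    linarith)
  linarith
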